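/- arXiv:2401.01225 — 6 statements merged into one kernel-verified Lean document; each statement's English description precedes it below -/
import Mathlib

section
/- For all integers n ≥ 1 and 0 ≤ k ≤ n, the number J^P_{k,n} of maximal configurations of length n with exactly k occupied lots that are resistant to predators equals the binomial coefficient C(n−k+1, 2k−n−1), with the convention that the binomial coefficient is 0 when 2k−n−1 < 0 or 2k−n−1 > n−k+1. -/
open Filter

/-- A configuration of length `n`: lots are indexed `1,…,n`; houses may only stand there. -/
def InRange (n : ℕ) (c : ℕ → Bool) : Prop := ∀ i, c i = true → 1 ≤ i ∧ i ≤ n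

/-- Lot `i` receives sunlight: it is a boundary lot, or one of its neighbours is empty. -/
def Sun (n : ℕ) (c : ℕ → Bool) (i : ℕ) : Prop :=
  i = 1 ∨ i = n ∨ c (i - 1) = false ∨ c (i + 1) = false

/-- Every occupied lot receives sunlight. -/
def Permissible (n : ℕ) (c : ℕ → Bool) : Prop := ∀ i, c i = true → Sun n c i

/-- The configuration obtained by occupying lot `j`. -/
def occupy (c : ℕ → Bool) (j : ℕ) : ℕ → Bool := fun i => if i = j then true else c i

/-- Maximal (jammed): permissible, and occupying any empty lot breaks permissibility. -/
def IsMaximal (n : ℕ) (c : ℕ → Bool) : Prop :=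
  Permissible n c ∧ ∀ j, 1 ≤ j → j ≤ n → c j = false → ¬ Permissible n (occupy c j)

/-- Resistant to predators: a house built on any empty lot would get no sunlight. -/
def ResistPred (n : ℕ) (c : ℕ → Bool) : Prop :=
  ∀ j, 1 ≤ j → j ≤ n → c j = false → ¬ Sun n (occupy c j) j

/-- Resistant to altruists: a house built on any empty lot would cut off sunlight
from some other occupied lot. -/
def ResistAlt (n : ℕ) (c : ℕ → Bool) : Prop :=
  ∀ j, 1 ≤ j → j ≤ n → c j = false →
    ∃ i, i ≠ j ∧ c i = true ∧ ¬ Sun n (occupy c j) i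

/-- Number of occupied lots. -/
def occ (n : ℕ) (c : ℕ → Bool) : ℕ :=
  ((Finset.Icc 1 n).filter (fun i => c i = true)).card

/-- `JP k n`: number of maximal configurations of length `n` with `k` occupied lots
that are resistant to predators. -/
noncomputable def JP (k n : ℕ) : ℕ :=
  Nat.card {c : ℕ → Bool //
    InRange n c ∧ IsMaximal n c ∧ ResistPred n c ∧ occ n c = k}

def Good (n : ℕ) (c : ℕ → Bool) : Prop :=
  (∀ i, c i = true → 1 ≤ i ∧ i ≤ n) ∧
  (∀ j, 1 ≤ j → j ≤ n → c j = false → j ≠ 1 ∧ j ≠ n ∧ c (j - 1) = true ∧ c (j + 1) = true) ∧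
  (∀ i, c i = true → i = 1 ∨ i = n ∨ c (i - 1) = false ∨ c (i + 1) = false)

theorem good_iff (n : ℕ) (c : ℕ → Bool) :
    (InRange n c ∧ IsMaximal n c ∧ ResistPred n c) ↔ Good n c := by
  have key : ∀ j, 1 ≤ j → (¬ Sun n (occupy c j) j ↔
      (j ≠ 1 ∧ j ≠ n ∧ c (j - 1) = true ∧ c (j + 1) = true)) := by
    intro j hj
    have h1 : j - 1 ≠ j := by omega
    simp [Sun, occupy, h1]
  constructor
  · rintro ⟨h1, ⟨h2, _⟩, h3⟩
    exact ⟨h1, fun j a b h => (key j a).1 (h3 j a b h), h2⟩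
  · rintro ⟨h1, h2, h3⟩
    have h4 : ResistPred n c := fun j a b h => (key j a).2 (h2 j a b h)
    refine ⟨h1, ⟨h3, fun j a b h hp => h4 j a b h (hp j (by simp [occupy]))⟩, h4⟩

def VV (n : ℕ) (k : ℤ) : Set (ℕ → Bool) := {c | Good n c ∧ (occ n c : ℤ) = k}

def cc (c : ℕ → Bool) : ℕ → Bool
  | 0 => false
  | 1 => true
  | 2 => false
  | (i + 3) => c (i + 1)

def cd (c : ℕ → Bool) : ℕ → Bool
  | 0 => false
  | 1 => true
  | 2 => true
  | 3 => false
  | (i + 4) => c (i + 1)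

theorem occ_sum (n : ℕ) (c : ℕ → Bool) :
    occ n c = ∑ i ∈ Finset.range n, if c (i + 1) = true then 1 else 0 := by
  unfold occ
  rw [Finset.card_filter]
  have h := Finset.sum_Ico_eq_sum_range (fun i => if c i = true then 1 else 0) 1 (n + 1)
  have e : Finset.Icc 1 n = Finset.Ico 1 (n + 1) := by
    ext i; simp
  rw [e, h]
  simp only [Nat.add_sub_cancel, add_comm]

theorem occ_cc (n : ℕ) (c : ℕ → Bool) : occ (n + 2) (cc c) = occ n c + 1 := by
  simp only [occ_sum, Finset.sum_range_succ', cc]; simp [-Finset.sum_boole]; rfl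

theorem occ_cd (n : ℕ) (c : ℕ → Bool) : occ (n + 3) (cd c) = occ n c + 2 := by
  simp only [occ_sum, Finset.sum_range_succ', cd]; simp [-Finset.sum_boole]; rfl

theorem good_cc (n : ℕ) (hn : 1 ≤ n) (c : ℕ → Bool) (h : Good n c) : Good (n + 2) (cc c) := by
  obtain ⟨h1, h2, h3⟩ := h
  have e1 : c 1 = true := by
    by_contra h
    exact (h2 1 le_rfl hn (by simpa using h)).1 rfl
  have e0 : c 0 = false := by
    by_contra h
    have := h1 0 (by simpa using h)
    omega
  refine ⟨?_, ?_, ?_⟩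
  · rintro (_ | _ | _ | i) hi
    · simp [cc] at hi
    · omega
    · omega
    · have := h1 (i + 1) hi
      omega
  · rintro (_ | _ | _ | i) a b hi
    · omega
    · simp [cc] at hi
    · simp [cc, e1]; omega
    · have := h2 (i + 1) (by omega) (by omega) hi
      rcases i with _ | i
      · simp at this
      · simp [cc] at this ⊢
        refine ⟨by omega, this.2⟩
  · rintro (_ | _ | _ | i) hi
    · simp [cc] at hi
    · simp
    · simp [cc] at hi
    · have := h3 (i + 1) hi
      rcases i with _ | i
      · simp [cc]
      · simp [cc] at this ⊢
        exact this

theorem good_cd (n : ℕ) (hn : 1 ≤ n) (c : ℕ → Bool) (h : Good n c) : Good (n + 3) (cd c) := by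
  obtain ⟨h1, h2, h3⟩ := h
  have e1 : c 1 = true := by
    by_contra h
    exact (h2 1 le_rfl hn (by simpa using h)).1 rfl
  refine ⟨?_, ?_, ?_⟩
  · rintro (_ | _ | _ | _ | i) hi
    · simp [cd] at hi
    · omega
    · omega
    · omega
    · have := h1 (i + 1) hi
      omega
  · rintro (_ | _ | _ | _ | i) a b hi
    · omega
    · simp [cd] at hi
    · simp [cd] at hi
    · simp [cd, e1]; omega
    · have := h2 (i + 1) (by omega) (by omega) hi
      rcases i with _ | i
      · simp at this
      · simp [cd] at this ⊢
        refine ⟨by omega, this.2⟩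
  · rintro (_ | _ | _ | _ | i) hi
    · simp [cd] at hi
    · simp
    · simp [cd]
    · simp [cd] at hi
    · have := h3 (i + 1) hi
      rcases i with _ | i
      · simp [cd]
      · simp [cd] at this ⊢
        exact this

theorem good_ends {n : ℕ} (hn : 1 ≤ n) {c : ℕ → Bool} (h : Good n c) :
    c 0 = false ∧ c 1 = true ∧ c n = true ∧ ∀ i, n < i → c i = false := by
  obtain ⟨h1, h2, h3⟩ := h
  refine ⟨?_, ?_, ?_, ?_⟩
  · by_contra h
    have := h1 0 (by simpa using h)
    omega
  · by_contra h
    exact (h2 1 le_rfl hn (by simpa using h)).1 rfl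
  · by_contra h
    exact (h2 n hn le_rfl (by simpa using h)).2.1 rfl
  · intro i hi
    by_contra h
    have := h1 i (by simpa using h)
    omega

def tl (s : ℕ) (c : ℕ → Bool) : ℕ → Bool := fun i => if i = 0 then false else c (i + s)

theorem good_tl (n s : ℕ) (hs : 1 ≤ s) (hn : 1 ≤ n) (c : ℕ → Bool) (h : Good (n + s) c)
    (h0 : c s = false) : Good n (tl s c) := by
  obtain ⟨h1, h2, h3⟩ := h
  have e1 : c (s + 1) = true := (h2 s hs (by omega) h0).2.2.2
  refine ⟨?_, ?_, ?_⟩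
  · intro i hi
    rcases i with _ | i
    · simp [tl] at hi
    · have := h1 (i + 1 + s) (by simpa [tl] using hi)
      omega
  · intro j a b hj
    have hj' : c (j + s) = false := by
      have : j ≠ 0 := by omega
      simpa [tl, this] using hj
    have := h2 (j + s) (by omega) (by omega) hj'
    have hj1 : j ≠ 1 := by
      rintro rfl
      rw [add_comm] at hj'
      simp [hj'] at e1
    have q : j - 1 ≠ 0 := by omega
    have q1 : j + s - 1 = j - 1 + s := by omega
    have q2 : j + s + 1 = j + 1 + s := by omega
    rw [q1, q2] at this
    refine ⟨hj1, by omega, ?_, ?_⟩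
    · simp only [tl, q, if_false]; exact this.2.2.1
    · simp only [tl]; simpa using this.2.2.2
  · intro i hi
    rcases i with _ | i
    · simp [tl] at hi
    rcases i with _ | i
    · simp
    have := h3 (i + 1 + 1 + s) (by simpa [tl] using hi)
    have q1 : i + 1 + 1 + s - 1 = i + 1 + s := by omega
    have q2 : i + 1 + 1 + s + 1 = i + 1 + 1 + 1 + s := by omega
    rw [q1, q2] at this
    simp [tl]
    rcases this with h | h | h | h
    · omega
    · omega
    · exact Or.inr (Or.inl h)
    · exact Or.inr (Or.inr h)

theorem VV_rec (n : ℕ) (hn : 1 ≤ n) (k : ℤ) :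
    VV (n + 3) k = cc '' VV (n + 1) (k - 1) ∪ cd '' VV n (k - 2) := by
  ext c
  constructor
  · rintro ⟨h, hk⟩
    have he := good_ends (by omega) h
    cases h2 : c 2
    · left
      have hc : cc (tl 2 c) = c := by
        funext i
        rcases i with _ | _ | _ | i <;> simp [cc, tl, he, h2]
      refine ⟨tl 2 c, ⟨good_tl (n + 1) 2 (by norm_num) (by omega) c h h2, ?_⟩, hc⟩
      have := occ_cc (n + 1) (tl 2 c)
      rw [hc] at this
      have e : n + 1 + 2 = n + 3 := rfl
      rw [e] at this
      omega
    · right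
      have h3 : c 3 = false := by
        have := h.2.2 2 h2
        rcases this with h | h | h | h
        · omega
        · omega
        · simp [he] at h
        · exact h
      have hc : cd (tl 3 c) = c := by
        funext i
        rcases i with _ | _ | _ | _ | i <;> simp [cd, tl, he, h2, h3]
      refine ⟨tl 3 c, ⟨good_tl n 3 (by norm_num) (by omega) c h h3, ?_⟩, hc⟩
      have := occ_cd n (tl 3 c)
      rw [hc] at this
      omega
  · rintro (⟨c, ⟨h, hk⟩, rfl⟩ | ⟨c, ⟨h, hk⟩, rfl⟩)
    · refine ⟨good_cc (n + 1) (by omega) c h, ?_⟩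
      have : occ (n + 3) (cc c) = _ := occ_cc (n + 1) c
      omega
    · refine ⟨good_cd n (by omega) c h, ?_⟩
      have := occ_cd n c
      omega

def GG (n : ℕ) (k : ℤ) : ℕ :=
  if (n : ℤ) + 1 ≤ 2 * k ∧ k ≤ n then
    Nat.choose ((n : ℤ) - k + 1).toNat (2 * k - n - 1).toNat else 0

theorem GG_rec (n : ℕ) (hn : 1 ≤ n) (k : ℤ) :
    GG (n + 3) k = GG (n + 1) (k - 1) + GG n (k - 2) := by
  unfold GG
  push_cast
  by_cases h : (n : ℤ) + 4 ≤ 2 * k ∧ k ≤ n + 3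
  · rw [if_pos (by omega)]
    by_cases hk : k = n + 3
    · rw [if_neg (by omega), if_neg (by omega)]
      apply Nat.choose_eq_zero_of_lt
      omega
    · obtain ⟨m, hm⟩ : ∃ m : ℕ, (n : ℤ) + 3 - k = m + 1 := ⟨(n + 2 - k).toNat, by omega⟩
      rw [if_pos (by omega)]
      obtain ⟨d, hd⟩ : ∃ d : ℕ, 2 * k - n - 4 = d := ⟨(2 * k - n - 4).toNat, by omega⟩
      have a1 : ((n : ℤ) + 3 - k + 1).toNat = m + 2 := by omega
      have a2 : (2 * k - ((n : ℤ) + 3) - 1).toNat = d := by omega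
      have a3 : ((n : ℤ) + 1 - (k - 1) + 1).toNat = m + 1 := by omega
      have a4 : (2 * (k - 1) - ((n : ℤ) + 1) - 1).toNat = d := by omega
      have a5 : ((n : ℤ) - (k - 2) + 1).toNat = m + 1 := by omega
      have a6 : (2 * (k - 2) - (n : ℤ) - 1).toNat = d - 1 := by omega
      rw [a1, a2, a3, a4, a5, a6]
      rcases d with _ | d
      · rw [if_neg (by omega)]; simp
      · rw [if_pos (by omega), Nat.choose_succ_succ' (m + 1) d]
        simp [add_comm]
  · rw [if_neg (by omega), if_neg (by omega), if_neg (by omega)]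

theorem base (n : ℕ) (w : ℕ → Bool) (a : ℕ) (hw : Good n w) (ha : occ n w = a)
    (hu : ∀ c, Good n c → c = w) (hG : ∀ k : ℤ, GG n k = if k = a then 1 else 0) (k : ℤ) :
    (VV n k).Finite ∧ (VV n k).ncard = GG n k := by
  rw [hG]
  split_ifs with h
  · have : VV n k = {w} := by
      ext c
      constructor
      · rintro ⟨h, _⟩
        exact hu c h
      · rintro rfl
        exact ⟨hw, by rw [ha, h]⟩
    simp [this]
  · have : VV n k = ∅ := by
      ext c
      simp only [Set.mem_empty_iff_false, iff_false]
      rintro ⟨h', h2⟩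
      rw [hu c h', ha] at h2
      exact h h2.symm
    simp [this]

theorem main_count (n : ℕ) : ∀ k : ℤ, 
    (VV (n + 1) k).Finite ∧ (VV (n + 1) k).ncard = GG (n + 1) k := by
  induction n using Nat.strong_induction_on with
  | _ n ih =>
  rcases n with _ | _ | _ | n
  · apply base 1 (fun i => decide (i = 1)) 1
    · simp [Good]; grind
    · simp [occ_sum]
    · intro c h
      have he := good_ends (by omega) h
      funext i
      rcases i with _ | _ | i <;> simp [he]
    · intro k
      unfold GG
      by_cases hk : k = 1
      · subst hk; simp
      · rw [if_neg (by omega), if_neg (by simpa using hk)]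
  · apply base 2 (fun i => decide (i = 1 ∨ i = 2)) 2
    · simp [Good]; grind
    · decide
    · intro c h
      have he := good_ends (by omega) h
      funext i
      rcases i with _ | _ | _ | i <;> simp [he]
    · intro k
      unfold GG
      by_cases hk : k = 2
      · subst hk; simp
      · rw [if_neg (by omega), if_neg (by simpa using hk)]
  · apply base 3 (fun i => decide (i = 1 ∨ i = 3)) 2
    · simp [Good]; grind
    · decide
    · intro c h
      have he := good_ends (by omega) h
      have h2 : c 2 = false := by
        by_contra h'
        have := h.2.2 2 (by simpa using h')
        simp [he] at this
      funext i
      rcases i with _ | _ | _ | _ | i <;> simp [he, h2]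
    · intro k
      unfold GG
      by_cases hk : k = 2
      · subst hk; simp
      · by_cases h3 : k = 3
        · subst h3; simp
        · rw [if_neg (by omega), if_neg (by simpa using hk)]
  · intro k
    have r : VV (n + 3 + 1) k = _ := VV_rec (n + 1) (by omega) k
    have g : GG (n + 3 + 1) k = _ := GG_rec (n + 1) (by omega) k
    obtain ⟨f1, e1⟩ := ih (n + 1) (by omega) (k - 1)
    obtain ⟨f2, e2⟩ := ih n (by omega) (k - 2)
    change (VV (n + 3 + 1) k).Finite ∧ (VV (n + 3 + 1) k).ncard = GG (n + 3 + 1) k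
    rw [r, g]
    refine ⟨(f1.image _).union (f2.image _), ?_⟩
    rw [Set.ncard_union_eq ?_ (f1.image _) (f2.image _), Set.InjOn.ncard_image,
      Set.InjOn.ncard_image, e1, e2]
    · intro c hc c' hc' h
      have he := good_ends (by omega) hc.1
      have he' := good_ends (by omega) hc'.1
      funext i
      rcases i with _ | i
      · rw [he.1, he'.1]
      · exact congrFun h (i + 4)
    · intro c hc c' hc' h
      have he := good_ends (by omega) hc.1
      have he' := good_ends (by omega) hc'.1
      funext i
      rcases i with _ | i
      · rw [he.1, he'.1]
      · exact congrFun h (i + 3)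
    · rw [Set.disjoint_left]
      rintro _ ⟨c, _, rfl⟩ ⟨c', _, h⟩
      have := congrFun h 2
      simp [cc, cd] at this

/-- `J^P_{k,n} = C(n-k+1, 2k-n-1)`, the binomial coefficient being `0`
when `2k-n-1 < 0` (or, automatically, when `2k-n-1 > n-k+1`). -/
theorem stmt0 (n k : ℕ) (hn : 1 ≤ n) (hk : k ≤ n) :
    JP k n = if n + 1 ≤ 2 * k then Nat.choose (n - k + 1) (2 * k - n - 1) else 0 := by
  have h : JP k n = (VV n k).ncard := by
    rw [← Nat.card_coe_set_eq]
    unfold JP VV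
    apply Nat.card_congr
    apply Equiv.subtypeEquivRight
    intro c
    simp only [Set.mem_ofPred_eq, ← good_iff]
    constructor
    · rintro ⟨a, b, c, d⟩
      exact ⟨⟨a, b, c⟩, by rw [d]⟩
    · rintro ⟨⟨a, b, c⟩, d⟩
      exact ⟨a, b, c, by exact_mod_cast d⟩
  obtain ⟨m, rfl⟩ : ∃ m, n = m + 1 := ⟨n - 1, by omega⟩
  rw [h, (main_count m k).2]
  unfold GG
  by_cases hc : m + 1 + 1 ≤ 2 * k
  · rw [if_pos hc, if_pos (by omega)]
    congr 1 <;> omega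
  · rw [if_neg hc, if_neg (by omega)]
end

section
/- For every real number ρ with 1/2 < ρ < 2/3, the complexity function of maximal configurations resistant to predators satisfies S^P(ρ) = (1−ρ)·ln(1−ρ) − (2ρ−1)·ln(2ρ−1) − (2−3ρ)·ln(2−3ρ), where S^P(ρ) is the supremum, over all sequences ((k_i, n_i))_{i∈ℕ} of pairs of nonnegative integers with n_i → ∞ and k_i/n_i → ρ, of limsup_{i→∞} ln(max(J^P_{k_i,n_i}, 1))/n_i. -/
open Filter

/-- The complexity function (configurational entropy) of a doubly indexed family of
counts `J k n`, at density `ρ`. -/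
noncomputable def complexity (J : ℕ → ℕ → ℕ) (ρ : ℝ) : ℝ :=
  sSup {L : ℝ | ∃ k n : ℕ → ℕ,
    Tendsto (fun i => (n i : ℝ)) atTop atTop ∧
    Tendsto (fun i => (k i : ℝ) / (n i : ℝ)) atTop (nhds ρ) ∧
    L = limsup (fun i => Real.log ((max (J (k i) (n i)) 1 : ℕ) : ℝ) / (n i : ℝ)) atTop}


noncomputable def gS (j : ℕ) : ℝ := Real.log (j.factorial : ℝ) - (j * Real.log j - j)

lemma gS_tendsto : Tendsto (fun j : ℕ => gS j / (j:ℝ)) atTop (nhds 0) := by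
  have h1 := (Real.continuousAt_log (x := √Real.pi) (by positivity)).tendsto.comp
    Stirling.tendsto_stirlingSeq_sqrt_pi
  have h2 : Tendsto (fun j : ℕ => (j:ℝ)) atTop atTop := tendsto_natCast_atTop_atTop
  have h3 := h1.div_atTop h2
  have h4 : Tendsto (fun x : ℝ => Real.log x / x) atTop (nhds 0) := by
    have := Real.isLittleO_log_id_atTop.tendsto_div_nhds_zero
    simpa using this
  have h5 : Tendsto (fun j : ℕ => (2 * (j:ℝ))) atTop atTop :=
    h2.const_mul_atTop (by norm_num)
  have h6 := h4.comp h5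
  have h7 := h3.add h6
  rw [add_zero] at h7
  refine h7.congr' ?_
  filter_upwards [eventually_gt_atTop 0] with j hj
  have hj' : (0:ℝ) < j := by exact_mod_cast hj
  simp only [Function.comp, gS]
  rw [Stirling.log_stirlingSeq_formula, Real.log_div hj'.ne' (Real.exp_pos _).ne', Real.log_exp]
  field_simp
  ring

lemma fact_asymp (u n : ℕ → ℕ) (x : ℝ) (hx : 0 < x)
    (hn : Tendsto (fun i => (n i : ℝ)) atTop atTop)
    (hu : Tendsto (fun i => (u i : ℝ) / (n i : ℝ)) atTop (nhds x)) :
    Tendsto (fun i => (Real.log ((u i).factorial : ℝ) - (u i * Real.log (n i) - u i)) / (n i : ℝ))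
      atTop (nhds (x * Real.log x)) := by
  have hu' : Tendsto (fun i => (u i : ℝ)) atTop atTop := by
    refine (hu.pos_mul_atTop hx hn).congr' ?_
    filter_upwards [hn.eventually_gt_atTop 0] with i hi
    field_simp
  have hu'' : Tendsto u atTop atTop := tendsto_natCast_atTop_iff.mp hu'
  have h1 := (gS_tendsto.comp hu'').mul hu
  have h2 := hu.mul ((Real.continuousAt_log hx.ne').tendsto.comp hu)
  have h3 := h1.add h2
  rw [zero_mul, zero_add] at h3
  refine h3.congr' ?_
  filter_upwards [hn.eventually_gt_atTop 0, hu'.eventually_gt_atTop 0] with i hi hj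
  simp only [Function.comp, gS]
  rw [Real.log_div hj.ne' hi.ne']
  field_simp
  ring

lemma choose_asymp (B D n : ℕ → ℕ) (y z : ℝ) (hy : 0 < y) (hz : 0 < z)
    (hn : Tendsto (fun i => (n i : ℝ)) atTop atTop)
    (hB : Tendsto (fun i => (B i : ℝ) / (n i : ℝ)) atTop (nhds y))
    (hD : Tendsto (fun i => (D i : ℝ) / (n i : ℝ)) atTop (nhds z)) :
    Tendsto (fun i => Real.log ((B i + D i).choose (B i) : ℝ) / (n i : ℝ))
      atTop (nhds ((y + z) * Real.log (y + z) - y * Real.log y - z * Real.log z)) := by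
  have hN : Tendsto (fun i => ((B i + D i : ℕ) : ℝ) / (n i : ℝ)) atTop (nhds (y + z)) := by
    refine (hB.add hD).congr fun i => ?_
    push_cast; ring
  have h := ((fact_asymp _ n _ (by positivity) hn hN).sub (fact_asymp _ n _ hy hn hB)).sub
    (fact_asymp _ n _ hz hn hD)
  refine h.congr fun i => ?_
  rw [Nat.cast_add_choose, Real.log_div (by positivity) (by positivity),
    Real.log_mul (by positivity) (by positivity)]
  push_cast
  ring

/-- valid words with `m` zeros -/
def SW (m n : ℕ) : Set (ℕ → Bool) :=
  {c | 1 ≤ n ∧ InRange n c ∧ (∀ j, 1 ≤ j → j ≤ n → c j = false →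
      1 < j ∧ j < n ∧ c (j-1) = true ∧ c (j+1) = true) ∧
    (∀ i, ¬ (c i = true ∧ c (i+1) = true ∧ c (i+2) = true)) ∧ occ n c + m = n}

def sh2 (d : ℕ → Bool) : ℕ → Bool := fun i => if i = 1 then true else d (i - 2)
def sh3 (d : ℕ → Bool) : ℕ → Bool := fun i => if i = 1 ∨ i = 2 then true else d (i - 3)

lemma sh2_inj : Function.Injective sh2 := by
  intro a b h
  funext i
  have := congrFun h (i+2)
  simpa [sh2] using this

lemma sh3_inj : Function.Injective sh3 := by
  intro a b h
  funext i
  have := congrFun h (i+3)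
  simpa [sh3] using this

lemma occ_succ_add (n : ℕ) (c : ℕ → Bool) :
    occ n c = ∑ i ∈ Finset.range n, (c (i+1)).toNat := by
  induction n with
  | zero => simp [occ]
  | succ n ih =>
    rw [Finset.sum_range_succ, ← ih]
    unfold occ
    rw [← Finset.insert_Icc_right_eq_Icc_add_one (by omega), Finset.filter_insert]
    cases h : c (n+1) <;> simp

lemma occ_sh2 (n : ℕ) (d : ℕ → Bool) (h0 : d 0 = false) :
    occ (n+2) (sh2 d) = occ n d + 1 := by
  rw [occ_succ_add, occ_succ_add, Finset.sum_range_succ', Finset.sum_range_succ']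
  simp [sh2, h0]

lemma occ_sh3 (n : ℕ) (d : ℕ → Bool) (h0 : d 0 = false) :
    occ (n+3) (sh3 d) = occ n d + 2 := by
  rw [occ_succ_add, occ_succ_add, Finset.sum_range_succ', Finset.sum_range_succ',
    Finset.sum_range_succ']
  simp [sh3, h0]

lemma SW_fin (m n : ℕ) : (SW m n).Finite := by
  refine Set.Finite.of_injOn (f := fun c (i : Fin (n+1)) => c i) (t := Set.univ)
    (fun _ _ => Set.mem_univ _) ?_ Set.finite_univ
  intro a ha b hb h
  funext i
  by_cases hi : i < n + 1
  · exact congrFun h ⟨i, hi⟩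
  · have h1 : a i = false := by
      by_contra h; have := ha.2.1 i (by simpa using h); omega
    have h2 : b i = false := by
      by_contra h; have := hb.2.1 i (by simpa using h); omega
    rw [h1, h2]

lemma InRange.zero {n : ℕ} {c : ℕ → Bool} (h : InRange n c) : c 0 = false := by
  by_contra h'; have := h 0 (by simpa using h'); omega

lemma SW_rec (m n : ℕ) : SW (m+1) (n+3) = sh2 '' SW m (n+1) ∪ sh3 '' SW m n := by
  ext c
  constructor
  · rintro ⟨-, hr, hz, h3, ho⟩
    have c0 := hr.zero
    have c1 : c 1 = true := by
      by_contra h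
      have := hz 1 le_rfl (by omega) (by simpa using h)
      omega
    cases c2 : c 2
    · left
      have he : sh2 (fun i => c (i+2)) = c := by
        funext i
        rcases i with _ | _ | i <;> simp [sh2, c0, c1, c2]
      refine ⟨fun i => c (i+2), ⟨by omega, ?_, ?_, ?_, ?_⟩, he⟩
      · intro i hi
        have := hr _ hi
        rcases i with _ | i
        · simp [c2] at hi
        · omega
      · intro j hj1 hj2 hj
        obtain ⟨a, b, e, f⟩ := hz (j+2) (by omega) (by omega) hj
        obtain ⟨j, rfl⟩ : ∃ t, j = t + 1 := ⟨j-1, by omega⟩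
        refine ⟨?_, by omega, ?_, ?_⟩
        · rcases j with _ | j
          · simp [c2] at e
          · omega
        · simpa using e
        · exact f
      · intro i; exact h3 (i+2)
      · have := occ_sh2 (n+1) (fun i => c (i+2)) c2
        rw [he] at this
        rw [show n + 1 + 2 = n + 3 by ring] at this
        omega
    · right
      have c3 : c 3 = false := by
        by_contra h
        exact h3 1 ⟨c1, c2, by simpa using h⟩
      have h33 := hz 3 (by omega) (by omega) c3
      have he : sh3 (fun i => c (i+3)) = c := by
        funext i
        rcases i with _ | _ | _ | i <;> simp [sh3, c0, c1, c2, c3]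
      refine ⟨fun i => c (i+3), ⟨by omega, ?_, ?_, ?_, ?_⟩, he⟩
      · intro i hi
        have := hr _ hi
        rcases i with _ | i
        · simp [c3] at hi
        · omega
      · intro j hj1 hj2 hj
        obtain ⟨a, b, e, f⟩ := hz (j+3) (by omega) (by omega) hj
        obtain ⟨j, rfl⟩ : ∃ t, j = t + 1 := ⟨j-1, by omega⟩
        refine ⟨?_, by omega, ?_, ?_⟩
        · rcases j with _ | j
          · simp [c3] at e
          · omega
        · simpa using e
        · exact f
      · intro i; exact h3 (i+3)
      · have := occ_sh3 n (fun i => c (i+3)) c3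
        rw [he] at this
        omega
  · rintro (⟨d, ⟨hn, hr, hz, h3, ho⟩, rfl⟩ | ⟨d, ⟨hn, hr, hz, h3, ho⟩, rfl⟩)
    · have d0 := hr.zero
      have d1 : d 1 = true := by
        by_contra h
        have := hz 1 le_rfl (by omega) (by simpa using h)
        omega
      refine ⟨by omega, ?_, ?_, ?_, ?_⟩
      · intro i hi
        rcases i with _ | _ | i
        · simp [sh2, d0] at hi
        · omega
        · have := hr i (by simpa [sh2] using hi)
          omega
      · intro j hj1 hj2 hj
        rcases j with _ | _ | _ | j
        · omega
        · simp [sh2] at hj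
        · simp [sh2, d1]
        · obtain ⟨a, b, e, f⟩ := hz (j+1) (by omega) (by omega) (by simpa [sh2] using hj)
          refine ⟨by omega, by omega, ?_, ?_⟩
          · simpa [sh2] using e
          · simpa [sh2] using f
      · intro i hi
        rcases i with _ | _ | i
        · simp [sh2, d0] at hi
        · simp [sh2, d0] at hi
        · exact h3 i (by simpa [sh2] using hi)
      · have := occ_sh2 (n+1) d d0
        rw [show n + 1 + 2 = n + 3 by ring] at this
        omega
    · have d0 := hr.zero
      have d1 : d 1 = true := by
        by_contra h
        have := hz 1 le_rfl (by omega) (by simpa using h)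
        omega
      refine ⟨by omega, ?_, ?_, ?_, ?_⟩
      · intro i hi
        rcases i with _ | _ | _ | i
        · simp [sh3, d0] at hi
        · omega
        · omega
        · have := hr i (by simpa [sh3] using hi)
          omega
      · intro j hj1 hj2 hj
        rcases j with _ | _ | _ | _ | j
        · omega
        · simp [sh3] at hj
        · simp [sh3] at hj
        · simp [sh3, d1]; omega
        · obtain ⟨a, b, e, f⟩ := hz (j+1) (by omega) (by omega) (by simpa [sh3] using hj)
          refine ⟨by omega, by omega, ?_, ?_⟩
          · simpa [sh3] using e
          · simpa [sh3] using f
      · intro i hi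
        rcases i with _ | _ | _ | i
        · simp [sh3, d0] at hi
        · simp [sh3, d0] at hi
        · simp [sh3, d0] at hi
        · exact h3 i (by simpa [sh3] using hi)
      · have := occ_sh3 n d d0
        omega

lemma SW_card_rec (m n : ℕ) :
    (SW (m+1) (n+3)).ncard = (SW m (n+1)).ncard + (SW m n).ncard := by
  rw [SW_rec, Set.ncard_union_eq _ ((SW_fin _ _).image _) ((SW_fin _ _).image _),
    Set.ncard_image_of_injective _ sh2_inj, Set.ncard_image_of_injective _ sh3_inj]
  rw [Set.disjoint_left]
  rintro c ⟨d, hd, rfl⟩ ⟨e, he, h⟩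
  have := congrFun h 2
  simp [sh2, sh3, hd.2.1.zero] at this

lemma SW_small (m n : ℕ) (hn : n ≤ 2) : SW (m+1) n = ∅ := by
  ext c
  simp only [Set.mem_empty_iff_false, iff_false]
  rintro ⟨h1, hr, hz, h3, ho⟩
  have key : ∀ j, 1 ≤ j → j ≤ n → c j = true := by
    intro j a b
    by_contra h
    have := hz j a b (by simpa using h)
    omega
  have : occ n c = n := by
    unfold occ
    rw [Finset.filter_true_of_mem]
    · simp
    · intro i hi
      rw [Finset.mem_Icc] at hi
      exact key i hi.1 hi.2
  omega

lemma SW_zero_all {n : ℕ} {c : ℕ → Bool} (h : c ∈ SW 0 n) :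
    c = fun i => decide (1 ≤ i ∧ i ≤ n) := by
  obtain ⟨h1, hr, hz, h3, ho⟩ := h
  have h' : ((Finset.Icc 1 n).filter (fun i => c i = true)) = Finset.Icc 1 n := by
    apply Finset.eq_of_subset_of_card_le (Finset.filter_subset _ _)
    unfold occ at ho
    simp; omega
  rw [Finset.filter_eq_self] at h'
  funext i
  by_cases hi : 1 ≤ i ∧ i ≤ n
  · rw [h' i (by simpa using hi)]; simp [hi]
  · have : c i = false := by
      by_contra h; exact hi (hr i (by simpa using h))
    rw [this]; simp only [hi, decide_false]

lemma SW_zero_small (n : ℕ) (h1 : 1 ≤ n) (h2 : n ≤ 2) : (SW 0 n).ncard = 1 := by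
  rw [Set.ncard_eq_one]
  refine ⟨fun i => decide (1 ≤ i ∧ i ≤ n), ?_⟩
  ext c
  constructor
  · intro h; exact SW_zero_all h
  · rintro rfl
    refine ⟨h1, ?_, ?_, ?_, ?_⟩
    · intro i hi; simpa using hi
    · intro j a b h; simp at h; omega
    · intro i; simp; omega
    · unfold occ
      rw [Finset.filter_true_of_mem]
      · simp
      · intro i hi; simpa using hi

lemma SW_zero_big (n : ℕ) (h2 : n = 0 ∨ 2 < n) : (SW 0 n).ncard = 0 := by
  rw [Set.ncard_eq_zero (SW_fin _ _)]
  ext c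
  simp only [Set.mem_empty_iff_false, iff_false]
  intro h
  have h1 := h.1
  have := SW_zero_all h
  refine h.2.2.2.1 1 ?_
  rw [this]; simp; omega

lemma SW_lt (m n : ℕ) (h : n < 2 * m + 1) : (SW m n).ncard = 0 := by
  induction m generalizing n with
  | zero => exact SW_zero_big n (by omega)
  | succ m ih =>
    rcases Nat.lt_or_ge n 3 with h' | h'
    · rw [SW_small m n (by omega)]; simp
    · obtain ⟨n, rfl⟩ := Nat.exists_eq_add_of_le' h'
      rw [SW_card_rec, ih _ (by omega), ih _ (by omega)]

lemma SW_card (m b : ℕ) : (SW m (2 * m + 1 + b)).ncard = (m+1).choose b := by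
  induction m generalizing b with
  | zero =>
    rcases b with _ | _ | b
    · rw [SW_zero_small _ (by omega) (by omega)]; simp
    · rw [SW_zero_small _ (by omega) (by omega)]; simp
    · rw [SW_zero_big _ (by omega), Nat.choose_eq_zero_of_lt (by omega)]
  | succ m ih =>
    rw [show 2 * (m+1) + 1 + b = (2 * m + b) + 3 by ring, SW_card_rec,
      show 2 * m + b + 1 = 2 * m + 1 + b by ring, ih]
    rcases b with _ | b
    · rw [SW_lt _ _ (by omega)]; simp
    · rw [show 2 * m + (b+1) = 2 * m + 1 + b by ring, ih, Nat.choose_succ_succ (m+1) b]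
      ring

lemma JP_eq (m n k : ℕ) (hn : 1 ≤ n) (hk : k + m = n) : JP k n = (SW m n).ncard := by
  unfold JP
  rw [← Nat.card_coe_set_eq]
  congr 1
  have : {c : ℕ → Bool | InRange n c ∧ IsMaximal n c ∧ ResistPred n c ∧ occ n c = k} = SW m n := by
    ext c
    constructor
    · rintro ⟨hr, hm, hp, ho⟩
      refine ⟨hn, hr, ?_, ?_, by omega⟩
      · intro j a b h
        have h' := hp j a b h
        simp only [Sun, occupy, not_or] at h'
        obtain ⟨x, y, z, w⟩ := h'
        rw [if_neg (by omega)] at z w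
        exact ⟨by omega, by omega, by simpa using z, by simpa using w⟩
      · rintro i ⟨a, b, d⟩
        have h0 := hr _ a
        have h2 := hr _ d
        rcases hm.1 (i+1) b with h | h | h | h
        · omega
        · omega
        · simp [a] at h
        · simp [d] at h
    · rintro ⟨-, hr, hz, h3, ho⟩
      have hp : ResistPred n c := by
        intro j a b h
        obtain ⟨x, y, z, w⟩ := hz j a b h
        simp only [Sun, occupy, not_or]
        rw [if_neg (by omega), if_neg (by omega)]
        exact ⟨by omega, by omega, by simpa using z, by simpa using w⟩
      refine ⟨hr, ⟨?_, ?_⟩, hp, by omega⟩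
      · intro i hi
        obtain ⟨i, rfl⟩ : ∃ t, i = t + 1 := ⟨i-1, by have := hr i hi; omega⟩
        by_contra h
        simp only [Sun, not_or] at h
        exact h3 i ⟨by simpa using h.2.2.1, hi, by simpa using h.2.2.2⟩
      · intro j a b h hperm
        exact hp j a b h (hperm j (by simp [occupy]))
  rw [← this]
  rfl

lemma JP_choose (k n : ℕ) (h1 : k ≤ n) (h2 : n + 1 ≤ 2 * k) (h3 : 3 * k ≤ 2 * n) :
    JP k n = ((2 * k - n - 1) + (2 * n + 2 - 3 * k)).choose (2 * k - n - 1) := by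
  rw [JP_eq (n - k) n k (by omega) (by omega)]
  have := SW_card (n - k) (2 * k - n - 1)
  rw [show 2 * (n - k) + 1 + (2 * k - n - 1) = n by omega] at this
  rw [this]
  congr 1
  omega

lemma JP_asymp (ρ : ℝ) (h1 : 1 / 2 < ρ) (h2 : ρ < 2 / 3) (k n : ℕ → ℕ)
    (hn : Tendsto (fun i => (n i : ℝ)) atTop atTop)
    (hk : Tendsto (fun i => (k i : ℝ) / (n i : ℝ)) atTop (nhds ρ)) :
    Tendsto (fun i => Real.log ((max (JP (k i) (n i)) 1 : ℕ) : ℝ) / (n i : ℝ)) atTop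
      (nhds ((1 - ρ) * Real.log (1 - ρ) - (2 * ρ - 1) * Real.log (2 * ρ - 1)
        - (2 - 3 * ρ) * Real.log (2 - 3 * ρ))) := by
  have hc : ∀ C : ℝ, Tendsto (fun i => C / (n i : ℝ)) atTop (nhds 0) := fun C => hn.const_div_atTop C
  have hB0 : Tendsto (fun i => 2 * ((k i : ℝ) / (n i : ℝ)) - 1 - 1 / (n i : ℝ)) atTop
      (nhds (2 * ρ - 1)) := by
    simpa using ((hk.const_mul 2).sub_const 1).sub (hc 1)
  have hD0 : Tendsto (fun i => 2 + 2 / (n i : ℝ) - 3 * ((k i : ℝ) / (n i : ℝ))) atTop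
      (nhds (2 - 3 * ρ)) := by
    simpa using ((hc 2).const_add 2).sub (hk.const_mul 3)
  have hD1 : Tendsto (fun i => 2 - 3 * ((k i : ℝ) / (n i : ℝ))) atTop
      (nhds (2 - 3 * ρ)) := by
    simpa using (hk.const_mul 3).const_sub 2
  have ev : ∀ᶠ i in atTop, 0 < (n i : ℝ) ∧ k i ≤ n i ∧ n i + 1 ≤ 2 * k i ∧ 3 * k i ≤ 2 * n i := by
    filter_upwards [hn.eventually_gt_atTop 0, hB0.eventually_const_lt (u := 0) (by linarith),
      hD1.eventually_const_lt (u := 0) (by linarith)] with i a b d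
    have b' : (n i : ℝ) + 1 < 2 * k i := by
      have := mul_pos b a
      field_simp at this
      linarith
    have d' : 3 * (k i : ℝ) < 2 * n i := by
      have := mul_pos d a
      field_simp at this
      linarith
    have b'' : n i + 1 < 2 * k i := by exact_mod_cast b'
    have d'' : 3 * k i < 2 * n i := by exact_mod_cast d'
    exact ⟨a, by omega, by omega, by omega⟩
  have hB : Tendsto (fun i => ((2 * k i - n i - 1 : ℕ) : ℝ) / (n i : ℝ)) atTop
      (nhds (2 * ρ - 1)) := by
    refine hB0.congr' ?_
    filter_upwards [ev] with i ⟨a, b, d, e⟩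
    rw [Nat.cast_sub (by omega), Nat.cast_sub (by omega)]
    push_cast
    field_simp
  have hD : Tendsto (fun i => ((2 * n i + 2 - 3 * k i : ℕ) : ℝ) / (n i : ℝ)) atTop
      (nhds (2 - 3 * ρ)) := by
    refine hD0.congr' ?_
    filter_upwards [ev] with i ⟨a, b, d, e⟩
    rw [Nat.cast_sub (by omega)]
    push_cast
    field_simp
  have h := choose_asymp _ _ n _ _ (by linarith) (by linarith) hn hB hD
  rw [show 2 * ρ - 1 + (2 - 3 * ρ) = 1 - ρ by ring] at h
  refine h.congr' ?_
  filter_upwards [ev] with i ⟨a, b, d, e⟩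
  rw [← JP_choose _ _ b d e, max_eq_left]
  rw [JP_choose _ _ b d e]
  exact Nat.choose_pos (by omega)

/-- the complexity function of maximal configurations resistant to
predators, for `1/2 < ρ < 2/3`. -/
theorem stmt2 (ρ : ℝ) (h1 : 1 / 2 < ρ) (h2 : ρ < 2 / 3) :
    complexity JP ρ =
      (1 - ρ) * Real.log (1 - ρ) - (2 * ρ - 1) * Real.log (2 * ρ - 1)
        - (2 - 3 * ρ) * Real.log (2 - 3 * ρ) := by
  unfold complexity
  rw [← csSup_singleton ((1 - ρ) * Real.log (1 - ρ) - (2 * ρ - 1) * Real.log (2 * ρ - 1)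
        - (2 - 3 * ρ) * Real.log (2 - 3 * ρ))]
  congr 1
  ext L
  simp only [Set.mem_setOf_eq, Set.mem_singleton_iff]
  constructor
  · rintro ⟨k, n, hn, hk, rfl⟩
    exact (JP_asymp ρ h1 h2 k n hn hk).limsup_eq
  · rintro rfl
    have hn : Tendsto (fun i : ℕ => (i : ℝ)) atTop atTop := tendsto_natCast_atTop_atTop
    have hk : Tendsto (fun i : ℕ => (⌊ρ * (i : ℝ)⌋₊ : ℝ) / (i : ℝ)) atTop (nhds ρ) :=
      (tendsto_nat_floor_mul_div_atTop (by linarith : (0:ℝ) ≤ ρ)).comp hn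
    exact ⟨fun i => ⌊ρ * (i : ℝ)⌋₊, fun i => i, hn, hk,
      (JP_asymp ρ h1 h2 _ _ hn hk).limsup_eq.symm⟩
end

section
/- Let P_n denote the total number of maximal configurations of length n that are resistant to predators. Then P_1 = P_2 = P_3 = 1 and P_n = P_{n−2} + P_{n−3} for all n ≥ 4 (i.e., the sequence (P_n) satisfies the Padovan recurrence). -/
open Filter

/-- `Pn n`: the total number of maximal configurations of length `n` that are
resistant to predators. -/
noncomputable def Pn (n : ℕ) : ℕ :=
  Nat.card {c : ℕ → Bool // InRange n c ∧ IsMaximal n c ∧ ResistPred n c}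

def GoodP (n : ℕ) (c : ℕ → Bool) : Prop :=
  (∀ i, c i = true → 1 ≤ i ∧ i ≤ n) ∧ c 1 = true ∧ c n = true ∧
  (∀ j, 1 ≤ j → j + 2 ≤ n → c (j + 1) = false → c j = true ∧ c (j + 2) = true) ∧
  (∀ j, 1 ≤ j → j + 2 ≤ n → c (j + 1) = true → c j = false ∨ c (j + 2) = false)

theorem goodP_iff (n : ℕ) (hn : 1 ≤ n) (c : ℕ → Bool) :
    (InRange n c ∧ IsMaximal n c ∧ ResistPred n c) ↔ GoodP n c := by
  constructor
  · rintro ⟨h1, ⟨h2, -⟩, h4⟩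
    refine ⟨h1, ?_, ?_, ?_, ?_⟩
    · by_contra h
      exact h4 1 le_rfl hn (by simpa using h) (Or.inl rfl)
    · by_contra h
      exact h4 n hn le_rfl (by simpa using h) (Or.inr (Or.inl rfl))
    · intro j hj hjn h
      have := h4 (j + 1) (by omega) (by omega) h
      simp only [Sun, occupy] at this
      grind
    · intro j hj hjn h
      have := h2 (j + 1) h
      simp only [Sun] at this
      grind
  · rintro ⟨h1, h2, h3, h4, h5⟩
    have hR : ResistPred n c := by
      intro j hj hjn h hs
      have a1 : j ≠ 1 := by rintro rfl; simp [h2] at h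
      have a2 : j ≠ n := by rintro rfl; simp [h3] at h
      obtain ⟨k, rfl⟩ : ∃ k, j = k + 1 := ⟨j - 1, by omega⟩
      have := h4 k (by omega) (by omega) h
      simp only [Sun, occupy] at hs
      grind
    refine ⟨h1, ⟨?_, ?_⟩, hR⟩
    · intro i hi
      have := h1 i hi
      by_cases a1 : i = 1
      · exact Or.inl a1
      by_cases a2 : i = n
      · exact Or.inr (Or.inl a2)
      obtain ⟨k, rfl⟩ : ∃ k, i = k + 1 := ⟨i - 1, by omega⟩
      exact Or.inr (Or.inr (h5 k (by omega) (by omega) hi))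
    · intro j hj hjn h hp
      exact hR j hj hjn h (hp j (by simp [occupy]))

theorem Pn_eq (n : ℕ) (hn : 1 ≤ n) : Pn n = Nat.card {c : ℕ → Bool // GoodP n c} :=
  Nat.card_congr (Equiv.subtypeEquivRight (goodP_iff n hn))

theorem finGoodP (n : ℕ) : Finite {c : ℕ → Bool // GoodP n c} := by
  refine Finite.of_injective (β := Fin (n + 1) → Bool) (fun c i => c.1 i) ?_
  intro c d h
  apply Subtype.ext
  funext i
  by_cases hi : i < n + 1
  · exact congrFun h ⟨i, hi⟩
  · have := c.2.1 i
    have := d.2.1 i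
    grind

theorem card_one (n : ℕ) (d : ℕ → Bool) (hd : GoodP n d) (h : ∀ c, GoodP n c → c = d) :
    Nat.card {c : ℕ → Bool // GoodP n c} = 1 := by
  rw [Nat.card_eq_one_iff_exists]
  exact ⟨⟨d, hd⟩, fun c => Subtype.ext (h c.1 c.2)⟩

def preA (c : ℕ → Bool) : ℕ → Bool := fun i => if i = 1 then true else if i ≤ 2 then false else c (i - 2)
def preB (c : ℕ → Bool) : ℕ → Bool :=
  fun i => if i = 1 ∨ i = 2 then true else if i ≤ 3 then false else c (i - 3)
def shf (k : ℕ) (c : ℕ → Bool) : ℕ → Bool := fun i => if i = 0 then false else c (i + k)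

theorem cs3 (j : ℕ) (hj : 1 ≤ j) : j = 1 ∨ j = 2 ∨ ∃ k, j = k + 3 := by
  by_cases h : 3 ≤ j
  · exact Or.inr (Or.inr ⟨j - 3, by omega⟩)
  · omega

theorem cs4 (j : ℕ) (hj : 1 ≤ j) : j = 1 ∨ j = 2 ∨ j = 3 ∨ ∃ k, j = k + 4 := by
  by_cases h : 4 ≤ j
  · exact Or.inr (Or.inr (Or.inr ⟨j - 4, by omega⟩))
  · omega

theorem goodA (m : ℕ) (c : ℕ → Bool) (h : GoodP (m + 2) c) : GoodP (m + 4) (preA c) := by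
  obtain ⟨h1, h2, h3, h4, h5⟩ := h
  refine ⟨?_, by simp [preA], by simpa [preA] using h3, ?_, ?_⟩
  · intro i hi
    have := h1 (i - 2)
    grind [preA]
  · intro j hj hjn
    rcases cs3 j hj with rfl | rfl | ⟨k, rfl⟩
    · simp [preA, h2]
    · simp [preA, h2]
    · have := h4 (k + 1) (by omega) (by omega)
      simpa [preA] using this
  · intro j hj hjn
    rcases cs3 j hj with rfl | rfl | ⟨k, rfl⟩
    · simp [preA]
    · simp [preA]
    · have := h5 (k + 1) (by omega) (by omega)
      simpa [preA] using this

theorem goodB (m : ℕ) (c : ℕ → Bool) (h : GoodP (m + 1) c) : GoodP (m + 4) (preB c) := by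
  obtain ⟨h1, h2, h3, h4, h5⟩ := h
  refine ⟨?_, by simp [preB], by simpa [preB] using h3, ?_, ?_⟩
  · intro i hi
    have := h1 (i - 3)
    grind [preB]
  · intro j hj hjn
    rcases cs4 j hj with rfl | rfl | rfl | ⟨k, rfl⟩
    · simp [preB]
    · simp [preB, h2]
    · simp [preB, h2]
    · have := h4 (k + 1) (by omega) (by omega)
      simpa [preB] using this
  · intro j hj hjn
    rcases cs4 j hj with rfl | rfl | rfl | ⟨k, rfl⟩
    · simp [preB]
    · simp [preB]
    · simp [preB]
    · have := h5 (k + 1) (by omega) (by omega)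
      simpa [preB] using this

theorem good_shf (n k : ℕ) (hn : 1 ≤ n) (c : ℕ → Bool) (h : GoodP (n + k) c)
    (hk : c (1 + k) = true) : GoodP n (shf k c) := by
  obtain ⟨h1, h2, h3, h4, h5⟩ := h
  refine ⟨?_, by simpa [shf] using hk, ?_, ?_, ?_⟩
  · intro i hi
    have := h1 (i + k)
    grind [shf]
  · have : n ≠ 0 := by omega
    simpa [shf, this] using h3
  · intro j hj hjn
    have := h4 (j + k) (by omega) (by omega)
    have e1 : j + 1 + k = j + k + 1 := by omega
    have e2 : j + 2 + k = j + k + 2 := by omega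
    have e3 : j ≠ 0 := by omega
    simpa [shf, e1, e2, e3] using this
  · intro j hj hjn
    have := h5 (j + k) (by omega) (by omega)
    have e1 : j + 1 + k = j + k + 1 := by omega
    have e2 : j + 2 + k = j + k + 2 := by omega
    have e3 : j ≠ 0 := by omega
    simpa [shf, e1, e2, e3] using this

theorem zero_of_good {n : ℕ} {c : ℕ → Bool} (h : GoodP n c) : c 0 = false := by
  have := h.1 0
  grind

theorem step (m : ℕ) : Nat.card {c : ℕ → Bool // GoodP (m + 4) c} =
    Nat.card {c : ℕ → Bool // GoodP (m + 2) c} + Nat.card {c : ℕ → Bool // GoodP (m + 1) c} := by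
  have := finGoodP (m + 2)
  have := finGoodP (m + 1)
  rw [← Nat.card_sum]
  symm
  refine Nat.card_congr (Equiv.ofBijective (Sum.elim
    (fun c => ⟨preA c.1, goodA m c.1 c.2⟩) (fun c => ⟨preB c.1, goodB m c.1 c.2⟩)) ⟨?_, ?_⟩)
  · rintro (⟨c, hc⟩ | ⟨c, hc⟩) (⟨d, hd⟩ | ⟨d, hd⟩) h
    · have h' : preA c = preA d := congrArg Subtype.val h
      congr 2
      funext i
      rcases Nat.eq_zero_or_pos i with rfl | hi
      · rw [zero_of_good hc, zero_of_good hd]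
      · have := congrFun h' (i + 2)
        simpa [preA, hi.ne'] using this
    · have h' : preA c = preB d := congrArg Subtype.val h
      have := congrFun h' 2
      simp [preA, preB] at this
    · have h' : preB c = preA d := congrArg Subtype.val h
      have := congrFun h' 2
      simp [preA, preB] at this
    · have h' : preB c = preB d := congrArg Subtype.val h
      congr 2
      funext i
      rcases Nat.eq_zero_or_pos i with rfl | hi
      · rw [zero_of_good hc, zero_of_good hd]
      · have := congrFun h' (i + 3)
        simpa [preB, hi.ne'] using this
  · rintro ⟨c, hc⟩
    have h0 := zero_of_good hc
    have h1 := hc.2.1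
    have a1 := hc.2.2.2.1 1 le_rfl (by omega)
    have a2 := hc.2.2.2.1 2 (by omega) (by omega)
    have b1 := hc.2.2.2.2 1 le_rfl (by omega)
    norm_num at a1 a2 b1
    cases h2 : c 2
    · refine ⟨Sum.inl ⟨shf 2 c, good_shf (m + 2) 2 (by omega) c hc (a1 h2).2⟩, Subtype.ext ?_⟩
      funext i
      rcases Nat.eq_zero_or_pos i |>.imp_right (cs3 i) with rfl | rfl | rfl | ⟨k, rfl⟩ <;>
        simp [preA, shf, *]
    · have h3 : c 3 = false := by
        rcases b1 h2 with h | h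
        · simp [h1] at h
        · exact h
      refine ⟨Sum.inr ⟨shf 3 c, good_shf (m + 1) 3 (by omega) c hc (a2 h3).2⟩, Subtype.ext ?_⟩
      funext i
      rcases Nat.eq_zero_or_pos i |>.imp_right (cs4 i)
        with rfl | rfl | rfl | rfl | ⟨k, rfl⟩ <;>
        simp [preB, shf, *]

theorem base1 : Nat.card {c : ℕ → Bool // GoodP 1 c} = 1 := by
  refine card_one 1 (fun i => decide (i = 1)) ?_ ?_
  · refine ⟨?_, ?_, ?_, ?_, ?_⟩ <;> grind
  · rintro c ⟨h1, h2, h3, h4, h5⟩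
    funext i
    have := h1 i
    by_cases e : i = 1
    · subst e; simp [h2]
    · cases hh : c i <;> grind

theorem base2 : Nat.card {c : ℕ → Bool // GoodP 2 c} = 1 := by
  refine card_one 2 (fun i => decide (i = 1 ∨ i = 2)) ?_ ?_
  · refine ⟨?_, ?_, ?_, ?_, ?_⟩ <;> grind
  · rintro c ⟨h1, h2, h3, h4, h5⟩
    funext i
    have := h1 i
    grind

theorem base3 : Nat.card {c : ℕ → Bool // GoodP 3 c} = 1 := by
  refine card_one 3 (fun i => decide (i = 1 ∨ i = 3)) ?_ ?_
  · refine ⟨?_, ?_, ?_, ?_, ?_⟩ <;> grind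
  · rintro c ⟨h1, h2, h3, h4, h5⟩
    funext i
    have := h1 i
    have := h5 1 le_rfl le_rfl
    have e : i = 1 ∨ i = 2 ∨ i = 3 ∨ (i ≠ 1 ∧ i ≠ 2 ∧ i ≠ 3) := by omega
    rcases e with rfl | rfl | rfl | e <;> grind

/-- `(P_n)` satisfies the Padovan recurrence. -/
theorem stmt3 :
    Pn 1 = 1 ∧ Pn 2 = 1 ∧ Pn 3 = 1 ∧ ∀ n, 4 ≤ n → Pn n = Pn (n - 2) + Pn (n - 3) := by
  refine ⟨?_, ?_, ?_, ?_⟩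
  · rw [Pn_eq 1 le_rfl, base1]
  · rw [Pn_eq 2 (by omega), base2]
  · rw [Pn_eq 3 (by omega), base3]
  · intro n hn
    obtain ⟨m, rfl⟩ : ∃ m, n = m + 4 := ⟨n - 4, by omega⟩
    have e1 : m + 4 - 2 = m + 2 := by omega
    have e2 : m + 4 - 3 = m + 1 := by omega
    rw [e1, e2, Pn_eq _ (by omega), Pn_eq _ (by omega), Pn_eq _ (by omega), step]
end

section
/- In the ring of formal power series in two variables x, y over ℤ, the bivariate generating function F^A(x,y) = Σ_{n≥0} Σ_{0≤k≤n} J^A_{k,n} x^k y^n satisfies the identity (1 − x² y³ − x² y⁴ − x³ y⁵) · F^A(x,y) = 1 + x y + x² y² + x² y³ + x³ y⁴. -/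
open Filter

/-- `JA k n`: number of maximal configurations of length `n` with `k` occupied lots
that are resistant to altruists. -/
noncomputable def JA (k n : ℕ) : ℕ :=
  Nat.card {c : ℕ → Bool //
    InRange n c ∧ IsMaximal n c ∧ ResistAlt n c ∧ occ n c = k}

noncomputable def Xx : MvPowerSeries (Fin 2) ℤ := MvPowerSeries.X 0
noncomputable def Yy : MvPowerSeries (Fin 2) ℤ := MvPowerSeries.X 1

/-- The bivariate generating function of `JA`: coefficient of `x^k y^n` is `J^A_{k,n}`
(for `0 ≤ k ≤ n`). -/
noncomputable def FA : MvPowerSeries (Fin 2) ℤ :=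
  fun d => if d 0 ≤ d 1 then (JA (d 0) (d 1) : ℤ) else 0

namespace AltProof

def St : List Bool → Bool
  | true :: true :: _ => true
  | _ => false

def V : Bool → Bool → List Bool → Prop
  | _, _, [] => True
  | p, q, true :: l => ¬ (p = true ∧ q = true) ∧ V q true l
  | p, q, false :: l => ((p = true ∧ q = true) ∨ St l = true) ∧ V q false l

def e (p q : Bool) (l : List Bool) : ℕ → Bool
  | 0 => p
  | 1 => q
  | i + 2 => l.getD i false

lemma e_cons (p q b : Bool) (l : List Bool) (i : ℕ) : e p q (b :: l) (i + 1) = e q b l i := by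
  rcases i with _ | _ | i <;> simp [e]

lemma St_iff (l : List Bool) : St l = true ↔ (l.getD 0 false = true ∧ l.getD 1 false = true) := by
  rcases l with _ | ⟨_ | _, _ | ⟨_ | _, l⟩⟩ <;> simp [St]

lemma V_iff (l : List Bool) : ∀ p q, V p q l ↔ ∀ i < l.length,
    (e p q l (i+2) = true → ¬ (e p q l i = true ∧ e p q l (i+1) = true)) ∧
    (e p q l (i+2) = false → (e p q l i = true ∧ e p q l (i+1) = true) ∨
      (e p q l (i+3) = true ∧ e p q l (i+4) = true)) := by
  induction l with
  | nil => intro p q; simp [V]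
  | cons b l ih =>
    intro p q
    have h : V p q (b :: l) ↔ ((b = true → ¬ (p = true ∧ q = true)) ∧
      (b = false → (p = true ∧ q = true) ∨ St l = true)) ∧ V q b l := by
      cases b <;> simp [V]
    rw [h, ih, St_iff]
    constructor
    · rintro ⟨h1, h2⟩ i hi
      rcases i with _ | i
      · simpa [e] using h1
      · have := h2 i (by simpa using hi)
        simpa only [← e_cons p q b l] using this
    · intro h
      refine ⟨?_, ?_⟩
      · simpa [e] using h 0 (by simp)
      · intro i hi
        have := h (i+1) (by simpa using hi)
        simpa only [← e_cons p q b l] using this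

def toC (l : List Bool) (i : ℕ) : Bool := e false false l (i + 1)

lemma toC_zero (l : List Bool) : toC l 0 = false := rfl
lemma toC_succ (l : List Bool) (i : ℕ) : toC l (i+1) = l.getD i false := rfl

lemma inRange_toC (l : List Bool) : InRange l.length (toC l) := by
  intro i hi
  rcases i with _ | i
  · simp [toC_zero] at hi
  · rw [toC_succ] at hi
    by_contra h
    rw [List.getD_eq_default _ _ (by omega)] at hi
    simp at hi

lemma V_iff_toC (l : List Bool) : V false false l ↔ ∀ j, 1 ≤ j → j ≤ l.length →
    (toC l j = true → ¬ (2 ≤ j ∧ toC l (j-2) = true ∧ toC l (j-1) = true)) ∧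
    (toC l j = false → (2 ≤ j ∧ toC l (j-2) = true ∧ toC l (j-1) = true) ∨
      (toC l (j+1) = true ∧ toC l (j+2) = true)) := by
  rw [V_iff]
  have key : ∀ i, (e false false l i = true ∧ e false false l (i+1) = true) ↔
      (2 ≤ i+1 ∧ toC l (i+1-2) = true ∧ toC l (i+1-1) = true) := by
    intro i
    rcases i with _ | i
    · simp [e]
    · simp [toC]
  constructor
  · intro h j h1 h2
    obtain ⟨i, rfl⟩ : ∃ i, j = i + 1 := ⟨j-1, by omega⟩
    have := h i (by omega)
    rw [key] at this
    exact this
  · intro h i hi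
    have := h (i+1) (by omega) (by omega)
    rw [key]
    exact this

lemma char (n : ℕ) (c : ℕ → Bool) (hc : InRange n c) :
    (IsMaximal n c ∧ ResistAlt n c) ↔ ∀ j, 1 ≤ j → j ≤ n →
    (c j = true → ¬ (2 ≤ j ∧ c (j-2) = true ∧ c (j-1) = true)) ∧
    (c j = false → (2 ≤ j ∧ c (j-2) = true ∧ c (j-1) = true) ∨
      (c (j+1) = true ∧ c (j+2) = true)) := by
  have h0 : c 0 = false := by
    by_contra h
    have := hc 0 (by simpa using h)
    omega
  have hn : c (n+1) = false := by
    by_contra h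
    have := hc (n+1) (by simpa using h)
    omega
  constructor
  · rintro ⟨⟨hp, -⟩, hr⟩ j h1 h2
    refine ⟨?_, ?_⟩
    · rintro hj ⟨h3, h4, h5⟩
      have := hp (j-1) h5
      have h6 := hc _ h4
      have e1 : j - 1 - 1 = j - 2 := by omega
      have e2 : j - 1 + 1 = j := by omega
      unfold Sun at this
      rw [e1, e2, h4, hj] at this
      simp at this
      omega
    · intro hj
      obtain ⟨i, hij, hi, hs⟩ := hr j h1 h2 hj
      have hs2 := hp i hi
      have hi2 := hc i hi
      unfold Sun at hs hs2
      simp only [not_or, occupy] at hs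
      obtain ⟨a1, a2, a3, a4⟩ := hs
      rcases hs2 with h | h | h | h
      · exact absurd h a1
      · exact absurd h a2
      · have : i - 1 = j := by
          by_contra hh
          simp [hh, h] at a3
        right
        obtain rfl : i = j + 1 := by omega
        refine ⟨hi, ?_⟩
        have hne : ¬ (j + 1 + 1 = j) := by omega
        simpa [hne] using a4
      · have : i + 1 = j := by
          by_contra hh
          simp [hh, h] at a4
        left
        subst this
        refine ⟨by omega, ?_, hi⟩
        have : i - 1 ≠ i + 1 := by omega
        simpa [this] using a3
  · intro h
    have hp : Permissible n c := by
      intro i hi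
      unfold Sun
      by_contra hcon
      simp only [not_or, Bool.not_eq_false] at hcon
      obtain ⟨a1, a2, a3, a4⟩ := hcon
      have := hc _ hi
      have := hc _ a4
      exact (h (i+1) (by omega) (by omega)).1 a4 ⟨by omega, a3, hi⟩
    have hr : ResistAlt n c := by
      intro j h1 h2 hj
      rcases (h j h1 h2).2 hj with ⟨a, b, d⟩ | ⟨b, d⟩
      · have := hc _ b
        refine ⟨j-1, by omega, d, ?_⟩
        have e1 : j - 1 - 1 = j - 2 := by omega
        have e2 : j - 1 + 1 = j := by omega
        unfold Sun
        rw [e1, e2]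
        simp [occupy, b]
        omega
      · have := hc _ d
        refine ⟨j+1, by omega, b, ?_⟩
        unfold Sun
        simp [occupy, d]
        omega
    refine ⟨⟨hp, ?_⟩, hr⟩
    intro j h1 h2 hj hperm
    obtain ⟨i, hij, hi, hs⟩ := hr j h1 h2 hj
    exact hs (hperm i (by simp [occupy, hi]))

lemma occ_toC (l : List Bool) : occ l.length (toC l) = l.count true := by
  have h1 : ∀ l : List Bool, ∑ i ∈ Finset.range l.length, (if l.getD i false = true then 1 else 0)
      = l.count true := by
    intro l
    induction l with
    | nil => simp
    | cons b l ih =>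
      rw [List.length_cons, Finset.sum_range_succ']
      simp only [List.getD_cons_succ, List.getD_cons_zero, ih, List.count_cons]
      cases b <;> simp
  have h2 := Finset.sum_Ico_add' (fun i => if toC l i = true then 1 else 0) 0 l.length 1
  rw [← h1, occ, Finset.card_filter, Finset.range_eq_Ico]
  exact h2.symm

def L (S : Set (List Bool)) (k n : ℕ) : Set (List Bool) :=
  {l | l ∈ S ∧ l.count true = k ∧ l.length = n}

lemma L_fin (S k n) : (L S k n).Finite :=
  (List.finite_length_eq Bool n).subset (fun _ h => h.2.2)

lemma JA_eq (k n : ℕ) : JA k n = (L {l | V false false l} k n).ncard := by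
  rw [JA, ← Nat.card_coe_set_eq]
  symm
  refine Nat.card_congr (Equiv.ofBijective (fun l => ⟨toC l.1, ?_⟩) ⟨?_, ?_⟩)
  · obtain ⟨l, hV, hk, hn⟩ := l
    subst hn hk
    have hr := inRange_toC l
    have := (char _ _ hr).2 ((V_iff_toC l).1 hV)
    exact ⟨hr, this.1, this.2, occ_toC l⟩
  · rintro ⟨l, hV, hk, hn⟩ ⟨l', hV', hk', hn'⟩ h
    simp only [Subtype.mk.injEq] at h
    apply Subtype.ext
    show l = l'
    apply List.ext_getElem (by omega)
    intro i h1 h2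
    have := congrFun h (i+1)
    rw [toC_succ, toC_succ] at this
    rwa [List.getD_eq_getElem _ _ h1, List.getD_eq_getElem _ _ h2] at this
  · rintro ⟨c, hr, hm, ha, ho⟩
    have hl : (List.ofFn (fun i : Fin n => c (i+1))).length = n := by simp
    have hc : toC (List.ofFn (fun i : Fin n => c (i+1))) = c := by
      funext i
      rcases i with _ | i
      · rw [toC_zero]
        by_contra h
        have := hr 0 (by simpa using Ne.symm h)
        omega
      · rw [toC_succ]
        by_cases hi : i < n
        · rw [List.getD_eq_getElem _ _ (by omega)]
          simp
        · rw [List.getD_eq_default _ _ (by omega)]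
          by_contra h
          have := hr (i+1) (by simpa using Ne.symm h)
          omega
    refine ⟨⟨List.ofFn (fun i : Fin n => c (i+1)), ?_, ?_, hl⟩, ?_⟩
    · show V _ _ _
      rw [V_iff_toC, hc, hl]
      exact (char n c hr).1 ⟨hm, ha⟩
    · rw [← occ_toC, hc, hl, ho]
    · exact Subtype.ext hc

noncomputable def gf (S : Set (List Bool)) : MvPowerSeries (Fin 2) ℤ :=
  fun d => ((L S (d 0) (d 1)).ncard : ℤ)

lemma FA_eq : FA = gf {l | V false false l} := by
  funext d
  rw [FA, gf, JA_eq]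
  split_ifs with h
  · rfl
  · symm
    rw [Nat.cast_eq_zero, Set.ncard_eq_zero (L_fin _ _ _)]
    rw [Set.eq_empty_iff_forall_notMem]
    rintro l ⟨-, h1, h2⟩
    have := List.count_le_length (a := true) (l := l)
    omega

lemma gf_empty : gf ∅ = 0 := by
  ext d
  show ((L ∅ (d 0) (d 1)).ncard : ℤ) = 0
  simp [L]

open Classical in
lemma ncard_L (S : Set (List Bool)) (k n : ℕ) : (L S k n).ncard =
    (if [] ∈ S ∧ k = 0 ∧ n = 0 then 1 else 0)
    + (if 1 ≤ k ∧ 1 ≤ n then (L {l | true :: l ∈ S} (k-1) (n-1)).ncard else 0)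
    + (if 1 ≤ n then (L {l | false :: l ∈ S} k (n-1)).ncard else 0) := by
  rcases n with _ | n
  · simp only [nonpos_iff_eq_zero, one_ne_zero, and_false, if_false, add_zero]
    split_ifs with h
    · rw [Set.ncard_eq_one]
      refine ⟨[], ?_⟩
      ext l
      simp only [L, Set.mem_setOf_eq, Set.mem_singleton_iff, List.length_eq_zero_iff]
      constructor
      · exact fun h => h.2.2
      · rintro rfl
        simp [h.1, h.2.1]
    · rw [Set.ncard_eq_zero (L_fin _ _ _), Set.eq_empty_iff_forall_notMem]
      rintro l ⟨h1, h2, h3⟩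
      rw [List.length_eq_zero_iff] at h3
      subst h3
      apply h
      simp at h2
      simp [h1, h2]
  · have hu : L S k (n+1) = (List.cons true '' {l | 1 ≤ k ∧ l ∈ L {l | true :: l ∈ S} (k-1) n}) ∪
        (List.cons false '' (L {l | false :: l ∈ S} k n)) := by
      ext l
      rcases l with _ | ⟨_ | _, l⟩
      · simp [L]
      · simp [L]
        try tauto
      · simp only [L, Set.mem_setOf_eq, Set.mem_union, Set.mem_image, List.count_cons, List.length_cons]
        simp
        constructor
        · rintro ⟨h0, h1, h2⟩; exact ⟨by omega, h0, by omega, h2⟩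
        · rintro ⟨h1, h0, h2, h3⟩; exact ⟨h0, by omega, h3⟩
    have f1 : {l | 1 ≤ k ∧ l ∈ L {l | true :: l ∈ S} (k-1) n}.Finite :=
      (L_fin _ _ _).subset (fun _ h => h.2)
    rw [hu, Set.ncard_union_eq _ (f1.image _) ((L_fin _ _ _).image _),
      Set.ncard_image_of_injective _ (List.cons_injective),
      Set.ncard_image_of_injective _ (List.cons_injective)]
    · by_cases hk : 1 ≤ k <;> simp [hk]
    · rw [Set.disjoint_left]
      rintro _ ⟨l, _, rfl⟩ ⟨l', _, h⟩
      simp at h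

open Classical in
lemma gf_step (S : Set (List Bool)) : gf S = (if [] ∈ S then 1 else 0)
    + Xx * Yy * gf {l | true :: l ∈ S} + Yy * gf {l | false :: l ∈ S} := by
  have hXY : Xx * Yy = MvPowerSeries.monomial (Finsupp.single 0 1 + Finsupp.single 1 1) (1:ℤ) := by
    rw [Xx, Yy, MvPowerSeries.X, MvPowerSeries.X, MvPowerSeries.monomial_mul_monomial, one_mul]
  have hY : Yy = MvPowerSeries.monomial (Finsupp.single 1 1) (1:ℤ) := rfl
  ext d
  rw [hXY, hY, map_add, map_add, MvPowerSeries.coeff_monomial_mul, MvPowerSeries.coeff_monomial_mul]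
  have hco : ∀ T d, MvPowerSeries.coeff d (gf T) = ((L T (d 0) (d 1)).ncard : ℤ) := fun _ _ => rfl
  rw [hco, hco, hco, ncard_L]
  have l1 : (Finsupp.single (0 : Fin 2) 1 + Finsupp.single 1 1 ≤ d) ↔ 1 ≤ d 0 ∧ 1 ≤ d 1 := by
    rw [Finsupp.le_def, Fin.forall_fin_two]; simp
  have l2 : (Finsupp.single (1 : Fin 2) 1 ≤ d) ↔ 1 ≤ d 1 := by
    rw [Finsupp.le_def, Fin.forall_fin_two]; simp
  have l3 : d = 0 ↔ d 0 = 0 ∧ d 1 = 0 := by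
    rw [Finsupp.ext_iff, Fin.forall_fin_two]; simp
  simp only [l1, l2]
  push_cast
  congr 1
  · congr 1
    · by_cases h : [] ∈ S
      · simp [h, MvPowerSeries.coeff_one, l3]
      · simp [h]
    · simp
  · simp

lemma gf_St (p q : Bool) (h : ¬ (q = true)) :
    gf {l | St l = true ∧ V p q l} = Xx ^ 2 * Yy ^ 2 * gf {l | V true true l} := by
  have hq : q = false := by simpa using h
  subst hq
  rw [gf_step, gf_step {l | true :: l ∈ _}]
  simp [St, V, gf_empty]
  ring

lemma gf_G : gf {l | V true true l} = 1 + Yy + Xx * Yy ^ 2 +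
    (Xx ^ 2 * Yy ^ 3 + Xx ^ 2 * Yy ^ 4 + Xx ^ 3 * Yy ^ 5) * gf {l | V true true l} := by
  have h1 := gf_step {l | V true true l}
  have h2 := gf_step {l | V true false l}
  have h3 := gf_step {l | V false true l}
  have h4 := gf_St false false (by simp)
  have h5 := gf_St true false (by simp)
  simp [V, gf_empty] at h1 h2 h3
  rw [h5] at h3
  rw [h4, h3] at h2
  rw [h2] at h1
  linear_combination h1

lemma gf_F : gf {l | V false false l} = 1 + Xx * Yy +
    (Xx ^ 2 * Yy ^ 2 + Xx ^ 2 * Yy ^ 3 + Xx ^ 3 * Yy ^ 4) * gf {l | V true true l} := by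
  have h1 := gf_step {l | V false false l}
  have h3 := gf_step {l | V false true l}
  have h4 := gf_St false false (by simp)
  have h5 := gf_St true false (by simp)
  simp [V, gf_empty] at h1 h3
  rw [h5] at h3
  rw [h4, h3] at h1
  linear_combination h1

end AltProof

/-- `(1 - x² y³ - x² y⁴ - x³ y⁵) F^A(x,y) = 1 + x y + x² y² + x² y³ + x³ y⁴`. -/
theorem stmt5 :
    (1 - Xx ^ 2 * Yy ^ 3 - Xx ^ 2 * Yy ^ 4 - Xx ^ 3 * Yy ^ 5) * FA =
      1 + Xx * Yy + Xx ^ 2 * Yy ^ 2 + Xx ^ 2 * Yy ^ 3 + Xx ^ 3 * Yy ^ 4 := by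
  rw [AltProof.FA_eq, AltProof.gf_F]
  linear_combination (Xx ^ 2 * Yy ^ 2 + Xx ^ 2 * Yy ^ 3 + Xx ^ 3 * Yy ^ 4) * AltProof.gf_G
end

section
/- For every real number ρ with 1/2 < ρ < 2/3, the complexity function of maximal configurations resistant to altruists satisfies S^A(ρ) = (1−ρ)·ln(1−ρ) − (2ρ−1)·ln(2ρ−1) − (2−3ρ)·ln(2−3ρ), where S^A(ρ) is the supremum, over all sequences ((k_i, n_i))_{i∈ℕ} of pairs of nonnegative integers with n_i → ∞ and k_i/n_i → ρ, of limsup_{i→∞} ln(max(J^A_{k_i,n_i}, 1))/n_i. -/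
open Filter

def Val (n : ℕ) (c : ℕ → Bool) : Prop :=
  InRange n c ∧ (∀ i, c i = true → c (i+1) = true → c (i+2) = true → False) ∧
  ∀ j, 1 ≤ j → j ≤ n → c j = false →
    ∃ p, c p = true ∧ c (p+1) = true ∧ (p + 2 = j ∨ j + 1 = p)

lemma val_iff (n : ℕ) (c : ℕ → Bool) :
    (InRange n c ∧ IsMaximal n c ∧ ResistAlt n c) ↔ Val n c := by
  constructor
  · rintro ⟨hr, ⟨hp, -⟩, ha⟩
    refine ⟨hr, ?_, ?_⟩
    · intro i h0 h1 h2
      have a0 := hr _ h0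
      have a2 := hr _ h2
      rcases hp _ h1 with h | h | h | h
      · omega
      · omega
      · simp [h0] at h
      · simp [h2] at h
    · intro j j1 jn hj
      obtain ⟨i, hij, hi, hs⟩ := ha j j1 jn hj
      have hs0 := hp i hi
      have hri := hr i hi
      simp only [Sun, not_or, occupy, Bool.not_eq_false] at hs hs0
      obtain ⟨s1, s2, s3, s4⟩ := hs
      have e : i - 1 + 1 = i := by omega
      split_ifs at s3 s4 with e1 e2 e2
      · omega
      · exact ⟨i, hi, s4, by omega⟩
      · exact ⟨i-1, s3, by rw [e]; exact hi, by omega⟩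
      · simp [s1, s2, s3, s4] at hs0
  · rintro ⟨hr, h3, hz⟩
    have hA : ResistAlt n c := by
      intro j j1 jn hj
      obtain ⟨p, hp, hp1, h | h⟩ := hz j j1 jn hj
      · have := hr _ hp
        refine ⟨p+1, by omega, hp1, ?_⟩
        simp only [Sun, not_or, occupy, Bool.not_eq_false]
        refine ⟨by omega, by omega, ?_, ?_⟩
        · simp [hp]
        · simp [← h]
      · have := hr _ hp1
        refine ⟨p, by omega, hp, ?_⟩
        simp only [Sun, not_or, occupy, Bool.not_eq_false]
        refine ⟨by omega, by omega, ?_, ?_⟩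
        · rw [if_pos (by omega)]
        · simp [hp1]
    refine ⟨hr, ⟨?_, ?_⟩, hA⟩
    · intro i hi
      have := hr _ hi
      unfold Sun
      by_contra hs
      simp only [not_or, Bool.not_eq_false] at hs
      obtain ⟨s1, s2, s3, s4⟩ := hs
      have e : i - 1 + 1 = i := by omega
      exact h3 (i-1) s3 (by rw [e]; exact hi) (by rw [show i - 1 + 2 = i + 1 by omega]; exact s4)
    · intro j j1 jn hj hP
      obtain ⟨i, hij, hi, hs⟩ := hA j j1 jn hj
      exact hs (hP i (by simp [occupy, hi]))

def L (c : ℕ → Bool) : ℕ → ℕ → List Bool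
  | _, 0 => []
  | p, m+1 => c p :: L c (p+1) m

lemma L_length (c : ℕ → Bool) (m : ℕ) : ∀ p, (L c p m).length = m := by
  induction m with
  | zero => intro p; rfl
  | succ m ih => intro p; simp [L, ih]

lemma L_count (c : ℕ → Bool) (m : ℕ) : ∀ p, (L c p m).count true =
    ((Finset.Ico p (p+m)).filter (fun i => c i = true)).card := by
  induction m with
  | zero => intro p; simp [L]
  | succ m ih =>
    intro p
    rw [Finset.card_filter, Finset.sum_eq_sum_Ico_succ_bot (by omega), ← Finset.card_filter,
      show p + (m+1) = p + 1 + m by omega, ← ih]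
    cases h : c p <;> simp [L, h, add_comm]

lemma L_inj (c d : ℕ → Bool) (m : ℕ) : ∀ p, L c p m = L d p m →
    ∀ i, p ≤ i → i < p + m → c i = d i := by
  induction m with
  | zero => intro p _ i; omega
  | succ m ih =>
    intro p h i h1 h2
    simp only [L, List.cons.injEq] at h
    rcases h1.eq_or_lt with e | e
    · rw [← e]; exact h.1
    · exact ih _ h.2 i (by omega) (by omega)

lemma occ_eq (n : ℕ) (c : ℕ → Bool) : occ n c = (L c 1 n).count true := by
  rw [L_count]; unfold occ
  congr 2
  ext i; simp; omega

def T : ℕ → List (List Bool)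
  | 0 => [[]]
  | 1 => [[false]]
  | 2 => [[false, true]]
  | 3 => (T 0).map ([false, true, true] ++ ·)
  | 4 => (T 1).map ([false, true, true] ++ ·) ++ (T 0).map ([false, false, true, true] ++ ·)
  | n+5 => (T (n+2)).map ([false, true, true] ++ ·) ++ ((T (n+1)).map ([false, false, true, true] ++ ·)
      ++ (T n).map ([false, true, false, true, true] ++ ·))

lemma mem_T (n : ℕ) (c : ℕ → Bool) (h : Val n c) (m : ℕ) : ∀ p, c p = true → c (p+1) = true →
    p + 1 + m = n → L c (p+2) m ∈ T m := by
  obtain ⟨hr, h3, hz⟩ := h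
  induction m using Nat.strong_induction_on with
  | _ m ih =>
  intro p hp hp1 hn
  have hp2 : c (p+2) = false := by
    have := h3 p hp hp1; grind
  have ho : ∀ i, n < i → c i = false := by
    intro i hi
    by_contra hc
    have := hr i (by simpa using hc)
    omega
  -- zero at `p+3`
  have z3 : p + 3 ≤ n → c (p+3) = false → c (p+4) = true ∧ c (p+5) = true := by
    intro hh h0
    obtain ⟨q, q0, q1, e | e⟩ := hz (p+3) (by omega) hh h0
    · obtain rfl : q = p+1 := by omega
      simp [hp2] at q1
    · subst e; exact ⟨q0, q1⟩
  have z4 : p + 4 ≤ n → c (p+4) = false → c (p+5) = true ∧ c (p+6) = true := by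
    intro hh h0
    obtain ⟨q, q0, q1, e | e⟩ := hz (p+4) (by omega) hh h0
    · obtain rfl : q = p+2 := by omega
      simp [hp2] at q0
    · subst e; exact ⟨q0, q1⟩
  have i3 : ∀ m', m' + 3 = m → c (p+3) = true → c (p+4) = true →
      L c (p+5) m' ∈ T m' := fun m' e a b => ih m' (by omega) (p+3) a b (by omega)
  have i4 : ∀ m', m' + 4 = m → c (p+4) = true → c (p+5) = true →
      L c (p+6) m' ∈ T m' := fun m' e a b => ih m' (by omega) (p+4) a b (by omega)
  have i5 : ∀ m', m' + 5 = m → c (p+5) = true → c (p+6) = true →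
      L c (p+7) m' ∈ T m' := fun m' e a b => ih m' (by omega) (p+5) a b (by omega)
  match m, hn with
  | 0, hn => simp [L, T]
  | 1, hn => simp [L, T, hp2]
  | 2, hn =>
    have := ho (p+4) (by omega)
    cases h : c (p+3) <;> simp_all [L, T]
  | 3, hn =>
    have a5 := ho (p+5) (by omega)
    have a6 := ho (p+6) (by omega)
    cases h : c (p+3)
    · have := z3 (by omega) h
      simp_all
    · cases h' : c (p+4)
      · have := z4 (by omega) h'
        simp_all
      · simp [L, T, hp2, h, h']
  | 4, hn =>
    have a6 := ho (p+6) (by omega)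
    cases h : c (p+3)
    · have := z3 (by omega) h
      simp [L, T, hp2, h, this]
    · cases h' : c (p+4)
      · have := z4 (by omega) h'
        simp_all
      · have := i3 1 rfl h h'
        simp only [L, T] at this
        simp [L, T, hp2, h, h']
        simpa using this
  | m+5, hn =>
    simp only [T, List.mem_append, List.mem_map]
    cases h : c (p+3)
    · have := z3 (by omega) h
      refine Or.inr (Or.inl ⟨_, i4 (m+1) rfl this.1 this.2, ?_⟩)
      simp [L, hp2, h, this]
    · cases h' : c (p+4)
      · have := z4 (by omega) h'
        refine Or.inr (Or.inr ⟨_, i5 m rfl this.1 this.2, ?_⟩)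
        simp [L, hp2, h, h', this]
      · refine Or.inl ⟨_, i3 (m+2) rfl h h', ?_⟩
        simp [L, hp2, h, h']

def F (m : ℕ) : List (List Bool) :=
  (T (m+2)).map ([true, true] ++ ·) ++ ((T (m+1)).map ([false, true, true] ++ ·)
      ++ (T m).map ([true, false, true, true] ++ ·))

lemma mem_F (m : ℕ) (c : ℕ → Bool) (h : Val (m+4) c) : L c 1 (m+4) ∈ F m := by
  have hT := mem_T _ c h
  obtain ⟨hr, h3, hz⟩ := h
  have c0 : c 0 = false := by
    by_contra hc
    have := hr 0 (by simpa using hc)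
    omega
  simp only [F, List.mem_append, List.mem_map]
  have z1 : c 1 = false → c 2 = true ∧ c 3 = true := by
    intro h0
    obtain ⟨q, q0, q1, e | e⟩ := hz 1 (by omega) (by omega) h0
    · omega
    · subst e; exact ⟨q0, q1⟩
  have z2 : c 2 = false → c 3 = true ∧ c 4 = true := by
    intro h0
    obtain ⟨q, q0, q1, e | e⟩ := hz 2 (by omega) (by omega) h0
    · obtain rfl : q = 0 := by omega
      simp [c0] at q0
    · subst e; exact ⟨q0, q1⟩
  cases h : c 1
  · have := z1 h
    refine Or.inr (Or.inl ⟨_, hT (m+1) 2 this.1 this.2 (by omega), ?_⟩)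
    simp [L, h, this]
  · cases h' : c 2
    · have := z2 h'
      refine Or.inr (Or.inr ⟨_, hT m 3 this.1 this.2 (by omega), ?_⟩)
      simp [L, h, h', this]
    · refine Or.inl ⟨_, hT (m+2) 1 h h' (by omega), ?_⟩
      simp [L, h, h']

noncomputable def wt (y : ℝ) (l : List (List Bool)) : ℝ := (l.map (fun w => y ^ (w.count true))).sum

lemma wt_append (y : ℝ) (a b : List (List Bool)) : wt y (a ++ b) = wt y a + wt y b := by
  simp [wt]

lemma wt_map (y : ℝ) (w : List Bool) (a : List (List Bool)) :
    wt y (a.map (w ++ ·)) = y ^ (w.count true) * wt y a := by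
  simp only [wt, List.map_map, ← List.sum_map_mul_left]
  congr 2
  ext v
  simp [pow_add]

lemma wt_nonneg (y : ℝ) (hy : 0 ≤ y) (a : List (List Bool)) : 0 ≤ wt y a := by
  apply List.sum_nonneg
  simp only [List.mem_map]
  rintro x ⟨w, -, rfl⟩
  positivity

lemma wt_filter (y : ℝ) (hy : 0 ≤ y) (k : ℕ) (a : List (List Bool)) :
    ((a.filter (fun w => w.count true = k)).length : ℝ) * y ^ k ≤ wt y a := by
  induction a with
  | nil => simp [wt]
  | cons w a ih =>
    have e : wt y (w :: a) = y ^ (w.count true) + wt y a := by simp [wt]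
    rw [e, List.filter_cons]
    have : 0 ≤ y ^ (w.count true) := by positivity
    split_ifs with h
    · have h : w.count true = k := by simpa using h
      rw [h]
      push_cast [List.length_cons]
      linarith
    · linarith

lemma wt_T_bound (u v t y : ℝ) (ht : 0 < t) (hy : 0 < y) (hu : 0 < u) (hv : 0 < v) (huv : u + v = 1)
    (eu : u = t^2*y) (ev : v = t^3*y^2) : ∃ C, 0 < C ∧ ∀ n, wt y (T n) * t ^ n ≤ C := by
  set S : ℕ → ℝ := fun n => wt y (T n) * t ^ n with hS
  have S0 : ∀ n, 0 ≤ S n := fun n => mul_nonneg (wt_nonneg y hy.le _) (by positivity)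
  refine ⟨S 0 + S 1 + S 2 + S 3 + S 4 + 1, ?_, ?_⟩
  · have := S0 0; have := S0 1; have := S0 2; have := S0 3; have := S0 4; linarith
  intro n
  change S n ≤ _
  have := S0 0; have := S0 1; have := S0 2; have := S0 3; have := S0 4
  induction n using Nat.strong_induction_on with
  | _ n ih =>
  match n with
  | 0 => linarith
  | 1 => linarith
  | 2 => linarith
  | 3 => linarith
  | 4 => linarith
  | n+5 =>
    have e : S (n+5) = v * S (n+2) + u^2 * S (n+1) + u * v * S n := by
      simp only [hS, T, wt_append, wt_map, eu, ev]
      simp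
      ring
    have e1 : u ^ 2 + u * v + v = 1 := by
      have : u = 1 - v := by linarith
      rw [this]; ring
    have h2 := ih (n+2) (by omega)
    have h1 := ih (n+1) (by omega)
    have h0 := ih n (by omega)
    rw [e]
    set C := S 0 + S 1 + S 2 + S 3 + S 4 + 1
    calc _ ≤ v * C + u^2 * C + u * v * C := by gcongr
      _ = (u ^ 2 + u * v + v) * C := by ring
      _ = C := by rw [e1, one_mul]

lemma JA_le (k m : ℕ) : JA k (m+4) ≤ ((F m).filter (fun w => w.count true = k)).length := by
  refine le_trans ?_ (List.toFinset_card_le _)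
  rw [JA, ← Nat.card_eq_finsetCard]
  refine Nat.card_le_card_of_injective (fun c => ⟨L c.1 1 (m+4), ?_⟩) ?_
  · obtain ⟨c, h1, h2, h3, h4⟩ := c
    have := mem_F m c ((val_iff _ _).1 ⟨h1, h2, h3⟩)
    rw [occ_eq] at h4
    simp [this, h4]
  · rintro ⟨c, h1, h2, h3, h4⟩ ⟨d, g1, g2, g3, g4⟩ h
    simp only [Subtype.mk.injEq] at h
    have := L_inj _ _ _ _ h
    rw [Subtype.mk.injEq]
    funext i
    by_cases hi : 1 ≤ i ∧ i ≤ m + 4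
    · exact this i hi.1 (by omega)
    · have a : c i = false := by
        by_contra hc
        exact hi (h1 i (by simpa using hc))
      have b : d i = false := by
        by_contra hc
        exact hi (g1 i (by simpa using hc))
      rw [a, b]

lemma JA_upper (u v t y : ℝ) (ht : 0 < t) (hy : 0 < y) (hu : 0 < u) (hv : 0 < v) (huv : u + v = 1)
    (eu : u = t^2*y) (ev : v = t^3*y^2) : ∃ C, 0 < C ∧ ∀ k n, 4 ≤ n → JA k n * y ^ k * t ^ n ≤ C := by
  obtain ⟨C, hC, h⟩ := wt_T_bound u v t y ht hy hu hv huv eu ev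
  refine ⟨y^2*t^2*C + y^2*t^3*C + y^3*t^4*C, by positivity, ?_⟩
  intro k n hn
  obtain ⟨m, rfl⟩ : ∃ m, n = m + 4 := ⟨n - 4, by omega⟩
  have h1 : (JA k (m+4) : ℝ) * y ^ k ≤ wt y (F m) := by
    refine le_trans ?_ (wt_filter y hy.le k (F m))
    gcongr
    exact_mod_cast JA_le k m
  have h2 : wt y (F m) * t ^ (m+4) = y^2*t^2*(wt y (T (m+2)) * t^(m+2))
      + y^2*t^3*(wt y (T (m+1)) * t^(m+1)) + y^3*t^4*(wt y (T m) * t^m) := by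
    simp only [F, wt_append, wt_map]
    simp
    ring
  calc _ ≤ wt y (F m) * t ^ (m+4) := by gcongr
    _ ≤ _ := by
      rw [h2]
      have a := h (m+2)
      have b := h (m+1)
      have c := h m
      gcongr
def fw : List Bool → List Bool
  | [] => [true, true]
  | [false] => [true, true, false, true]
  | true :: w => true :: true :: false :: fw w
  | false :: true :: w => true :: true :: false :: true :: false :: fw w
  | false :: false :: w => true :: true :: false :: false :: fw w

lemma fw_length (w : List Bool) : (fw w).length = 2 + 2 * w.count false + 3 * w.count true := by
  induction w using fw.induct <;> simp_all [fw] <;> omega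

lemma fw_count (w : List Bool) : (fw w).count true = 2 + w.count false + 2 * w.count true := by
  induction w using fw.induct <;> simp_all [fw] <;> omega

lemma fw_head (w : List Bool) : ∃ r, fw w = true :: true :: r := by
  induction w using fw.induct <;> simp [fw]

lemma fw_inj (w : List Bool) : ∀ w', fw w = fw w' → w = w' := by
  induction w using fw.induct with
  | case1 => 
    intro w'
    induction w' using fw.induct <;> simp [fw]
  | case2 => 
    intro w'
    induction w' using fw.induct with
    | case3 w _ => obtain ⟨r, hr⟩ := fw_head w; simp [fw, hr]
    | _ => simp [fw]
  | case3 w ih => 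
    intro w'
    obtain ⟨r, hr⟩ := fw_head w
    induction w' using fw.induct with
    | case3 w' _ => simp only [fw]; intro h; simp at h; rw [ih _ h]
    | _ => simp [fw, hr]
  | case4 w ih => 
    intro w'
    induction w' using fw.induct with
    | case4 w' _ => simp only [fw]; intro h; simp at h; rw [ih _ h]
    | case3 w' _ => obtain ⟨r, hr⟩ := fw_head w'; simp [fw, hr]
    | _ => simp [fw]
  | case5 w ih => 
    intro w'
    induction w' using fw.induct with
    | case5 w' _ => simp only [fw]; intro h; simp at h; rw [ih _ h]
    | case3 w' _ => obtain ⟨r, hr⟩ := fw_head w'; simp [fw, hr]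
    | _ => simp [fw]

def VL (l : List Bool) : Prop :=
  (∀ i, l.getD i false = true → l.getD (i+1) false = true → l.getD (i+2) false = true → False) ∧
  ∀ j, j < l.length → l.getD j false = false →
    ∃ p, l.getD p false = true ∧ l.getD (p+1) false = true ∧ (p + 2 = j ∨ j + 1 = p)

lemma fw_VL (w : List Bool) : VL (fw w) := by
  induction w using fw.induct with
  | case1 =>
    constructor
    · rintro (_ | _ | i) <;> simp [fw]
    · rintro (_ | _ | i) <;> simp [fw]
  | case2 =>
    constructor
    · rintro (_ | _ | _ | _ | i) <;> simp [fw]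
    · rintro (_ | _ | _ | _ | i) <;> simp [fw]
      exact ⟨0, by simp⟩
  | case3 w ih =>
    obtain ⟨h3, hz⟩ := ih
    constructor
    · rintro (_ | _ | _ | i) <;> simp only [fw, List.getD_cons_succ, List.getD_cons_zero] <;> try simp
      simpa using h3 i
    · rintro (_ | _ | _ | j) <;> simp only [fw, List.getD_cons_succ, List.getD_cons_zero] <;> try simp
      · exact ⟨0, by simp⟩
      · intro h1 h2
        obtain ⟨p, p0, p1, e⟩ := hz j h1 (by simpa using h2)
        exact ⟨p+3, by simpa using p0, by simpa using p1, by omega⟩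
  | case4 w ih =>
    obtain ⟨r, hr⟩ := fw_head w
    obtain ⟨h3, hz⟩ := ih
    constructor
    · rintro (_ | _ | _ | _ | _ | i) <;> simp only [fw, List.getD_cons_succ, List.getD_cons_zero] <;> try simp
      simpa using h3 i
    · rintro (_ | _ | _ | _ | _ | j) <;> simp only [fw, List.getD_cons_succ, List.getD_cons_zero] <;> try simp
      · exact ⟨0, by simp⟩
      · exact ⟨5, by simp [hr]⟩
      · intro h1 h2
        obtain ⟨p, p0, p1, e⟩ := hz j h1 (by simpa using h2)
        exact ⟨p+5, by simpa using p0, by simpa using p1, by omega⟩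
  | case5 w ih =>
    obtain ⟨r, hr⟩ := fw_head w
    obtain ⟨h3, hz⟩ := ih
    constructor
    · rintro (_ | _ | _ | _ | i) <;> simp only [fw, List.getD_cons_succ, List.getD_cons_zero] <;> try simp
      simpa using h3 i
    · rintro (_ | _ | _ | _ | j) <;> simp only [fw, List.getD_cons_succ, List.getD_cons_zero] <;> try simp
      · exact ⟨0, by simp⟩
      · exact ⟨4, by simp [hr]⟩
      · intro h1 h2
        obtain ⟨p, p0, p1, e⟩ := hz j h1 (by simpa using h2)
        exact ⟨p+4, by simpa using p0, by simpa using p1, by omega⟩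
def toC (l : List Bool) : ℕ → Bool
  | 0 => false
  | i+1 => l.getD i false

lemma toC_inRange (l : List Bool) : InRange l.length (toC l) := by
  rintro (_ | i) h
  · simp [toC] at h
  · simp only [toC] at h
    by_contra hc
    rw [List.getD_eq_default _ _ (by omega)] at h
    simp at h

lemma toC_val (l : List Bool) (h : VL l) : Val l.length (toC l) := by
  refine ⟨toC_inRange l, ?_, ?_⟩
  · rintro (_ | i) h0 h1 h2
    · simp [toC] at h0
    · exact h.1 i h0 h1 h2
  · rintro (_ | j) h0 h1 h2
    · omega
    · obtain ⟨p, p0, p1, e⟩ := h.2 j (by omega) h2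
      exact ⟨p+1, p0, p1, by omega⟩

lemma toC_L (l : List Bool) (d : ℕ → Bool) : ∀ p, (∀ i, i < l.length → d (p + i) = l.getD i false) →
    L d p l.length = l := by
  induction l with
  | nil => intro p _; rfl
  | cons a l ih =>
    intro p h
    simp only [L, List.length_cons, List.cons.injEq]
    refine ⟨by simpa using h 0 (by simp), ih _ ?_⟩
    intro i hi
    have := h (i+1) (by simpa using hi)
    rw [show p + 1 + i = p + (i + 1) by omega, this]
    simp

lemma toC_L' (l : List Bool) : L (toC l) 1 l.length = l :=
  toC_L l _ 1 (fun i _ => by rw [add_comm]; rfl)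

lemma fin_conf (k n : ℕ) : Finite {c : ℕ → Bool //
    InRange n c ∧ IsMaximal n c ∧ ResistAlt n c ∧ occ n c = k} := by
  refine Finite.of_injective (β := Fin (n+1) → Bool) (fun c i => c.1 i) ?_
  rintro ⟨c, h1, h2, h3, h4⟩ ⟨d, g1, g2, g3, g4⟩ h
  rw [Subtype.mk.injEq]
  funext i
  by_cases hi : 1 ≤ i ∧ i ≤ n
  · exact congrFun h ⟨i, by omega⟩
  · have a : c i = false := by
      by_contra hc
      exact hi (h1 i (by simpa using hc))
    have b : d i = false := by
      by_contra hc
      exact hi (g1 i (by simpa using hc))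
    rw [a, b]

lemma JA_lower (m j : ℕ) (hj : j ≤ m) :
    m.choose j ≤ JA (2 + (m - j) + 2 * j) (2 + 2 * (m - j) + 3 * j) := by
  have key : ∀ s ∈ Finset.powersetCard j (Finset.range m),
      (L (fun i => decide (i ∈ s)) 0 m).count true = j ∧
      (L (fun i => decide (i ∈ s)) 0 m).count false = m - j := by
    intro s hs
    rw [Finset.mem_powersetCard] at hs
    have h1 : (L (fun i => decide (i ∈ s)) 0 m).count true = j := by
      rw [L_count, ← hs.2]
      congr 1
      ext i
      have := @hs.1 i
      simp at this ⊢
      exact this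
    have h2 := List.count_true_add_count_false (L (fun i => decide (i ∈ s)) 0 m)
    rw [L_length] at h2
    exact ⟨h1, by omega⟩
  have hc : m.choose j = (Finset.powersetCard j (Finset.range m)).card := by simp
  rw [hc, JA, ← Nat.card_eq_finsetCard]
  have := fin_conf (2 + (m - j) + 2 * j) (2 + 2 * (m - j) + 3 * j)
  refine Nat.card_le_card_of_injective
    (fun s => ⟨toC (fw (L (fun i => decide (i ∈ s.1)) 0 m)), ?_⟩) ?_
  · obtain ⟨s, hs⟩ := s
    obtain ⟨k1, k2⟩ := key s hs
    have e1 := fw_length (L (fun i => decide (i ∈ s)) 0 m)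
    have e2 := fw_count (L (fun i => decide (i ∈ s)) 0 m)
    rw [k1, k2] at e1 e2
    have hv := toC_val _ (fw_VL (L (fun i => decide (i ∈ s)) 0 m))
    have ho := occ_eq (fw (L (fun i => decide (i ∈ s)) 0 m)).length (toC (fw (L (fun i => decide (i ∈ s)) 0 m)))
    rw [toC_L', e2, e1] at ho
    rw [e1] at hv
    obtain ⟨a, b, c⟩ := (val_iff _ _).2 hv
    exact ⟨a, b, c, ho⟩
  · rintro ⟨s, hs⟩ ⟨s', hs'⟩ h
    simp only [Subtype.mk.injEq] at h
    have e1 := fw_length (L (fun i => decide (i ∈ s)) 0 m)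
    have e1' := fw_length (L (fun i => decide (i ∈ s')) 0 m)
    rw [(key s hs).1, (key s hs).2] at e1
    rw [(key s' hs').1, (key s' hs').2] at e1'
    have h2 := toC_L' (fw (L (fun i => decide (i ∈ s)) 0 m))
    rw [h, e1, ← e1', toC_L'] at h2
    have h3 := fw_inj _ _ h2
    have h4 := L_inj _ _ _ _ h3
    rw [Subtype.mk.injEq]
    rw [Finset.mem_powersetCard] at hs hs'
    ext i
    by_cases hi : i < m
    · have := h4 i (by omega) (by omega)
      simpa [eq_comm] using this
    · have a := @hs.1 i
      have b := @hs'.1 i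
      simp at a b
      constructor
      · intro q; exact absurd (a q) hi
      · intro q; exact absurd (b q) hi

lemma binom_mode (u v : ℝ) (hu : 0 < u) (hv : 0 < v) (huv : u + v = 1) (m : ℕ) :
    ∃ j, j ≤ m ∧ 1 ≤ ((m:ℝ)+1) * ((m.choose j : ℝ) * v ^ j * u ^ (m-j)) ∧
      m * v - 1 ≤ j ∧ (j:ℝ) ≤ m * v + 1 := by
  set a : ℕ → ℝ := fun j => (m.choose j : ℝ) * v ^ j * u ^ (m-j) with ha
  obtain ⟨j, hj, hmax⟩ := Finset.exists_max_image (Finset.range (m+1)) a ⟨0, by simp⟩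
  have hjm : j ≤ m := by simp at hj; omega
  have ratio : ∀ i, i < m → a (i+1) * (i+1) * u = a i * (m - i) * v := by
    intro i hi
    have := Nat.choose_succ_right_eq m i
    have h' : (m.choose (i+1) : ℝ) * (i+1) = m.choose i * (m - i) := by
      have := congrArg (Nat.cast : ℕ → ℝ) this
      push_cast [Nat.cast_sub hi.le] at this
      exact this
    simp only [ha]
    have e : m - i = (m - (i+1)) + 1 := by omega
    rw [e, pow_succ, pow_succ]
    linear_combination (v ^ i * v * u ^ (m - (i+1)) * u) * h'
  have apos : ∀ i, i ≤ m → 0 < a i := by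
    intro i hi
    have : 0 < m.choose i := Nat.choose_pos hi
    simp only [ha]
    positivity
  refine ⟨j, hjm, ?_, ?_, ?_⟩
  · have hs : ∑ i ∈ Finset.range (m+1), a i = 1 := by
      have := add_pow v u m
      rw [add_comm, huv, one_pow] at this
      rw [this]
      apply Finset.sum_congr rfl
      intro i _
      simp only [ha]; ring
    have := Finset.sum_le_card_nsmul (Finset.range (m+1)) a (a j) hmax
    rw [hs] at this
    simpa using this
  · rcases hjm.eq_or_lt with e | e
    · subst e
      have : (j:ℝ) * v ≤ j * 1 := by gcongr; linarith
      linarith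
    · have h1 := ratio j e
      have h2 := hmax (j+1) (by simp; omega)
      have hp := apos j hjm
      have h3 : a j * ((m - j) * v) ≤ a j * ((j+1) * u) := by
        have : a (j+1) * ((j+1) * u) ≤ a j * ((j+1) * u) := by gcongr
        linarith
      have h4 := le_of_mul_le_mul_left h3 hp
      have : u = 1 - v := by linarith
      rw [this] at h4
      nlinarith
  · rcases j with _ | j
    · simp; positivity
    · have h1 := ratio j (by omega)
      have h2 := hmax j (by simp; omega)
      have hp := apos (j+1) hjm
      have hjm' : (j:ℝ) ≤ m := by exact_mod_cast (by omega : j ≤ m)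
      have h3 : a (j+1) * ((j+1) * u) ≤ a (j+1) * ((m - j) * v) := by
        have : a j * ((m - j) * v) ≤ a (j+1) * ((m - j) * v) := by
          apply mul_le_mul_of_nonneg_right h2
          apply mul_nonneg _ hv.le
          linarith
        linarith
      have h4 := le_of_mul_le_mul_left h3 hp
      have : u = 1 - v := by linarith
      rw [this] at h4
      push_cast
      nlinarith
lemma upper_seq (u v t y ρ H : ℝ) (ht : 0 < t) (hy : 0 < y) (hu : 0 < u) (hv : 0 < v) (huv : u + v = 1)
    (eu : u = t^2*y) (ev : v = t^3*y^2) (hH : H = - Real.log t - ρ * Real.log y) (H0 : 0 ≤ H)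
    (k n : ℕ → ℕ) (hn : Tendsto (fun i => (n i : ℝ)) atTop atTop)
    (hk : Tendsto (fun i => (k i : ℝ) / (n i : ℝ)) atTop (nhds ρ)) :
    ∃ h : ℕ → ℝ, Tendsto h atTop (nhds H) ∧
      (fun i => Real.log ((max (JA (k i) (n i)) 1 : ℕ) : ℝ) / (n i : ℝ)) ≤ᶠ[atTop] h := by
  obtain ⟨C, hC, hb⟩ := JA_upper u v t y ht hy hu hv huv eu ev
  refine ⟨fun i => max 0 (Real.log C / n i - Real.log t - (k i / n i) * Real.log y), ?_, ?_⟩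
  · have h1 : Tendsto (fun i => Real.log C / (n i : ℝ)) atTop (nhds 0) := hn.const_div_atTop _
    have h2 := (tendsto_const_nhds (x := (0:ℝ)) (f := atTop (α := ℕ))).max
      ((h1.sub_const (Real.log t)).sub (hk.mul_const (Real.log y)))
    rwa [zero_sub, ← hH, max_eq_right H0] at h2
  · filter_upwards [hn.eventually_ge_atTop 4] with i hi
    have hi' : 4 ≤ n i := by exact_mod_cast hi
    have hb := hb (k i) (n i) hi'
    rcases Nat.eq_zero_or_pos (JA (k i) (n i)) with h0 | h0
    · simp [h0]
    · rw [max_eq_left h0]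
      apply le_max_of_le_right
      have hJ : (0:ℝ) < JA (k i) (n i) := by exact_mod_cast h0
      have hl := Real.log_le_log (by positivity) hb
      rw [Real.log_mul (by positivity) (by positivity), Real.log_mul (by positivity) (by positivity),
        Real.log_pow, Real.log_pow] at hl
      have hn0 : (0:ℝ) < n i := by linarith
      have e : Real.log C / n i - Real.log t - (k i / n i) * Real.log y
        = (Real.log C - n i * Real.log t - k i * Real.log y) / n i := by
        field_simp
      rw [e]
      gcongr
      linarith

lemma lower_seq (u v ρ H : ℝ) (hu : 0 < u) (hv : 0 < v) (huv : u + v = 1)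
    (hρ : (1 + v) / (2 + v) = ρ) (hH : H = (- v * Real.log v - u * Real.log u) / (2 + v)) :
    ∃ k n : ℕ → ℕ, Tendsto (fun i => (n i : ℝ)) atTop atTop ∧
      Tendsto (fun i => (k i : ℝ) / (n i : ℝ)) atTop (nhds ρ) ∧
      ∃ g : ℕ → ℝ, Tendsto g atTop (nhds H) ∧
      g ≤ᶠ[atTop] (fun i => Real.log ((max (JA (k i) (n i)) 1 : ℕ) : ℝ) / (n i : ℝ)) := by
  choose j hj hc hl hr using binom_mode u v hu hv huv
  have hm : Tendsto (fun m : ℕ => (m:ℝ)) atTop atTop := tendsto_natCast_atTop_atTop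
  have hi : ∀ a : ℝ, Tendsto (fun m : ℕ => a / (m:ℝ)) atTop (nhds 0) := fun a => hm.const_div_atTop a
  have hjm : Tendsto (fun m : ℕ => (j m : ℝ) / m) atTop (nhds v) := by
    have a1 : Tendsto (fun m : ℕ => v - 1 / (m:ℝ)) atTop (nhds v) := by
      simpa using (hi 1).const_sub v
    have a2 : Tendsto (fun m : ℕ => v + 1 / (m:ℝ)) atTop (nhds v) := by
      simpa using (hi 1).const_add v
    refine tendsto_of_tendsto_of_tendsto_of_le_of_le' a1 a2 ?_ ?_
    · filter_upwards [eventually_gt_atTop 0] with m hm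
      have hm : (0:ℝ) < m := by exact_mod_cast hm
      rw [le_div_iff₀ hm, sub_mul, one_div, inv_mul_cancel₀ hm.ne']
      linarith [hl m]
    · filter_upwards [eventually_gt_atTop 0] with m hm
      have hm : (0:ℝ) < m := by exact_mod_cast hm
      rw [div_le_iff₀ hm, add_mul, one_div, inv_mul_cancel₀ hm.ne']
      linarith [hr m]
  have hlog : Tendsto (fun m : ℕ => Real.log ((m:ℝ)+1) / m) atTop (nhds 0) := by
    have := (Real.tendsto_pow_log_div_mul_add_atTop 1 (-1) 1 one_ne_zero).comp
      (tendsto_atTop_add_const_right atTop 1 hm)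
    refine this.congr ?_
    intro m
    simp
  have cn : ∀ m, ((2 + 2 * (m - j m) + 3 * j m : ℕ) : ℝ) = 2 + 2 * m + j m := by
    intro m; push_cast [Nat.cast_sub (hj m)]; ring
  have ck : ∀ m, ((2 + (m - j m) + 2 * j m : ℕ) : ℝ) = 2 + m + j m := by
    intro m; push_cast [Nat.cast_sub (hj m)]; ring
  have tn : Tendsto (fun m : ℕ => 2 / (m:ℝ) + 2 + (j m : ℝ) / m) atTop (nhds (2 + v)) := by
    simpa using ((hi 2).add_const 2).add hjm
  have tk : Tendsto (fun m : ℕ => 2 / (m:ℝ) + 1 + (j m : ℝ) / m) atTop (nhds (1 + v)) := by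
    simpa using ((hi 2).add_const 1).add hjm
  refine ⟨fun m => 2 + (m - j m) + 2 * j m, fun m => 2 + 2 * (m - j m) + 3 * j m, ?_, ?_,
    fun m => (- (Real.log ((m:ℝ)+1) / m) - ((j m : ℝ) / m) * Real.log v -
      (1 - (j m : ℝ) / m) * Real.log u) / (2 / (m:ℝ) + 2 + (j m : ℝ) / m), ?_, ?_⟩
  · refine tendsto_atTop_mono (fun m => ?_) hm
    rw [cn]
    have : (0:ℝ) ≤ m := by positivity
    have : (0:ℝ) ≤ j m := by positivity
    linarith
  · rw [← hρ]
    refine (tk.div tn (by positivity)).congr' ?_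
    filter_upwards [eventually_gt_atTop 0] with m hm
    have hm : (0:ℝ) < m := by exact_mod_cast hm
    rw [cn, ck]
    simp only [Pi.div_apply]
    field_simp
  · have := ((hlog.neg.sub (hjm.mul_const (Real.log v))).sub
      ((hjm.const_sub 1).mul_const (Real.log u))).div tn (by positivity)
    have e : H = (-0 - v * Real.log v - (1 - v) * Real.log u) / (2 + v) := by
      rw [hH, show 1 - v = u by linarith]; ring
    rw [e]
    exact this
  · filter_upwards [eventually_gt_atTop 0] with m hm
    have hm : (0:ℝ) < m := by exact_mod_cast hm
    have hJ := JA_lower m (j m) (hj m)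
    have hcp : 0 < m.choose (j m) := Nat.choose_pos (hj m)
    have hcp' : (0:ℝ) < m.choose (j m) := by exact_mod_cast hcp
    have h1 : Real.log (m.choose (j m)) ≤ Real.log ((max (JA (2 + (m - j m) + 2 * j m)
        (2 + 2 * (m - j m) + 3 * j m)) 1 : ℕ) : ℝ) := by
      apply Real.log_le_log hcp'
      exact_mod_cast hJ.trans (le_max_left _ _)
    have h2 := Real.log_le_log one_pos (hc m)
    rw [Real.log_mul (by positivity) (by positivity), Real.log_mul (by positivity) (by positivity),
      Real.log_mul (by positivity) (by positivity), Real.log_one, Real.log_pow, Real.log_pow,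
      Nat.cast_sub (hj m)] at h2
    rw [cn]
    have e : (- (Real.log ((m:ℝ)+1) / m) - ((j m : ℝ) / m) * Real.log v -
      (1 - (j m : ℝ) / m) * Real.log u) / (2 / (m:ℝ) + 2 + (j m : ℝ) / m) =
      (- Real.log ((m:ℝ)+1) - j m * Real.log v - (m - j m) * Real.log u) / (2 + 2 * m + j m) := by
      field_simp
    rw [e]
    gcongr
    linarith

/-- the complexity function of maximal configurations resistant to
altruists, for `1/2 < ρ < 2/3`. -/
theorem stmt6 (ρ : ℝ) (h1 : 1 / 2 < ρ) (h2 : ρ < 2 / 3) :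
    complexity JA ρ =
      (1 - ρ) * Real.log (1 - ρ) - (2 * ρ - 1) * Real.log (2 * ρ - 1)
        - (2 - 3 * ρ) * Real.log (2 - 3 * ρ) := by
  have pr : 0 < 1 - ρ := by linarith
  have pa : 0 < 2 - 3 * ρ := by linarith
  have pb : 0 < 2 * ρ - 1 := by linarith
  set H := (1 - ρ) * Real.log (1 - ρ) - (2 * ρ - 1) * Real.log (2 * ρ - 1)
        - (2 - 3 * ρ) * Real.log (2 - 3 * ρ) with hHdef
  obtain ⟨u, hu⟩ : ∃ u, u = (2 - 3 * ρ) / (1 - ρ) := ⟨_, rfl⟩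
  obtain ⟨v, hv⟩ : ∃ v, v = (2 * ρ - 1) / (1 - ρ) := ⟨_, rfl⟩
  have u0 : 0 < u := by rw [hu]; positivity
  have v0 : 0 < v := by rw [hv]; positivity
  have huv : u + v = 1 := by rw [hu, hv]; field_simp; ring
  have lu : Real.log u = Real.log (2 - 3 * ρ) - Real.log (1 - ρ) := by
    rw [hu, Real.log_div pa.ne' pr.ne']
  have lv : Real.log v = Real.log (2 * ρ - 1) - Real.log (1 - ρ) := by
    rw [hv, Real.log_div pb.ne' pr.ne']
  have v2 : 2 + v = 1 / (1 - ρ) := by rw [hv]; field_simp; ring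
  have hH2 : H = (- v * Real.log v - u * Real.log u) / (2 + v) := by
    rw [v2, lu, lv, hHdef, hu, hv]; field_simp; ring
  have H0 : 0 ≤ H := by
    rw [hH2]
    have := Real.log_nonpos u0.le (by linarith)
    have := Real.log_nonpos v0.le (by linarith)
    apply div_nonneg _ (by linarith)
    nlinarith
  have hρ : (1 + v) / (2 + v) = ρ := by
    rw [v2, hv]; field_simp; ring
  have eu : u = (u^2/v)^2*(v^2/u^3) := by field_simp
  have ev : v = (u^2/v)^3*(v^2/u^3)^2 := by field_simp
  have hH1 : H = - Real.log (u^2/v) - ρ * Real.log (v^2/u^3) := by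
    rw [Real.log_div (by positivity) (by positivity), Real.log_div (by positivity) (by positivity),
      Real.log_pow, Real.log_pow, Real.log_pow, lu, lv, hHdef]
    push_cast; ring
  have upper := upper_seq u v (u^2/v) (v^2/u^3) ρ H (by positivity) (by positivity) u0 v0 huv eu ev
    hH1 H0
  have fpos : ∀ k n : ℕ → ℕ, ∀ i, 0 ≤ Real.log ((max (JA (k i) (n i)) 1 : ℕ) : ℝ) / (n i : ℝ) := by
    intro k n i
    apply div_nonneg _ (by positivity)
    apply Real.log_nonneg
    exact_mod_cast le_max_right _ _
  have ub : ∀ k n : ℕ → ℕ, Tendsto (fun i => (n i : ℝ)) atTop atTop →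
      Tendsto (fun i => (k i : ℝ) / (n i : ℝ)) atTop (nhds ρ) →
      limsup (fun i => Real.log ((max (JA (k i) (n i)) 1 : ℕ) : ℝ) / (n i : ℝ)) atTop ≤ H := by
    intro k n hn hk
    obtain ⟨h, hh, hle⟩ := upper k n hn hk
    rw [← hh.limsup_eq]
    refine limsup_le_limsup hle ?_ hh.isBoundedUnder_le
    exact (isBoundedUnder_of ⟨0, fpos k n⟩ : IsBoundedUnder (· ≥ ·) atTop _).isCoboundedUnder_le
  have : IsGreatest {L : ℝ | ∃ k n : ℕ → ℕ,
    Tendsto (fun i => (n i : ℝ)) atTop atTop ∧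
    Tendsto (fun i => (k i : ℝ) / (n i : ℝ)) atTop (nhds ρ) ∧
    L = limsup (fun i => Real.log ((max (JA (k i) (n i)) 1 : ℕ) : ℝ) / (n i : ℝ)) atTop} H := by
    constructor
    · obtain ⟨k, n, hn, hk, g, hg, hle⟩ := lower_seq u v ρ H u0 v0 huv hρ hH2
      refine ⟨k, n, hn, hk, le_antisymm ?_ (ub k n hn hk)⟩
      obtain ⟨h, hh, hle'⟩ := upper k n hn hk
      rw [← hg.limsup_eq]
      refine limsup_le_limsup hle hg.isCoboundedUnder_le ?_
      exact hh.isBoundedUnder_le.mono_le hle'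
    · rintro x ⟨k, n, hn, hk, rfl⟩
      exact ub k n hn hk
  exact this.csSup_eq
end

section
/- In the ring of formal power series in two variables x, y over ℤ, the bivariate generating function F^{ES}(x,y) = Σ_{n≥0} Σ_{0≤k≤n} J^{ES}_{k,n} x^k y^n satisfies the identity (1 − x² y³ − x³ y⁵) · F^{ES}(x,y) = 1 + x y + x² y² − x² y³ + x³ y⁴ − x³ y⁵. -/
open Filter

/-- `JES k n`: number of evolutionary stable configurations of length `n`
with `k` occupied lots. -/
noncomputable def JES (k n : ℕ) : ℕ :=
  Nat.card {c : ℕ → Bool //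
    InRange n c ∧ IsMaximal n c ∧ ResistPred n c ∧ ResistAlt n c ∧ occ n c = k}

/-- The bivariate generating function of `JES`: coefficient of `x^k y^n` is
`J^{ES}_{k,n}` (for `0 ≤ k ≤ n`). -/
noncomputable def FES : MvPowerSeries (Fin 2) ℤ :=
  fun d => if d 0 ≤ d 1 then (JES (d 0) (d 1) : ℤ) else 0


def EE (n : ℕ) (c : ℕ → Bool) : Prop :=
  c 0 = false ∧ (∀ i, n < i → c i = false) ∧
  (∀ j, j < n → c (j+1) = false → c j = true ∧ c (j+2) = true ∧ (c (j-1) = true ∨ c (j+3) = true)) ∧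
  ∀ i, ¬ (c i = true ∧ c (i+1) = true ∧ c (i+2) = true)

def ff (c : ℕ → Bool) : ℕ → Bool
  | 0 => false | 1 => true | 2 => true | i+3 => c i

def gg (c : ℕ → Bool) : ℕ → Bool
  | 0 => false | 1 => true | 2 => false | 3 => true | 4 => true | i+5 => c i

lemma ff_inj : Function.Injective ff := fun a b h => by
  funext i; exact congrFun h (i+3)

lemma gg_inj : Function.Injective gg := fun a b h => by
  funext i; exact congrFun h (i+5)

lemma EE_iff (n : ℕ) (c : ℕ → Bool) :
    (InRange n c ∧ IsMaximal n c ∧ ResistPred n c ∧ ResistAlt n c) ↔ EE n c := by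
  constructor
  · rintro ⟨hr, ⟨hp, -⟩, h1, h2⟩
    have h0 : c 0 = false := by
      by_contra h; have := hr 0 (by simpa using h); omega
    have hn : ∀ i, n < i → c i = false := by
      intro i hi; by_contra h; have := hr i (by simpa using h); omega
    refine ⟨h0, hn, ?_, ?_⟩
    · intro j hj hc
      have a := h1 (j+1) (by omega) (by omega) hc
      obtain ⟨i, hi, hci, b⟩ := h2 (j+1) (by omega) (by omega) hc
      have p := hp i hci
      simp only [Sun, occupy] at a b p
      have hj2 : c j = true ∧ c (j+2) = true := by
        grind
      refine ⟨hj2.1, hj2.2, ?_⟩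
      have : i = j ∨ i = j + 2 := by grind
      grind
    · rintro i ⟨a, b, d⟩
      have p := hp _ b
      have := hr _ a
      have := hr _ d
      simp only [Sun] at p
      grind
  · rintro ⟨h0, hn, h1, h2⟩
    have hr : InRange n c := by
      intro i hi
      constructor
      · by_contra h; have : i = 0 := by omega
        grind
      · by_contra h; have := hn i (by omega); grind
    have hP : ResistPred n c := by
      intro j a b d
      obtain ⟨j, rfl⟩ : ∃ k, j = k + 1 := ⟨j-1, by omega⟩
      obtain ⟨x, y, -⟩ := h1 j (by omega) d
      have := hr _ x
      have := hr _ y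
      simp only [Sun, occupy]
      grind
    refine ⟨hr, ⟨?_, ?_⟩, hP, ?_⟩
    · intro i hi
      have := hr i hi
      obtain ⟨i, rfl⟩ : ∃ k, i = k + 1 := ⟨i-1, by omega⟩
      have := h2 i
      simp only [Sun]
      grind
    · intro j a b d h
      exact hP j a b d (h j (by simp [occupy]))
    · intro j a b d
      obtain ⟨j, rfl⟩ : ∃ k, j = k + 1 := ⟨j-1, by omega⟩
      obtain ⟨x, y, z⟩ := h1 j (by omega) d
      have hx := hr _ x
      have hy := hr _ y
      rcases z with z | z
      · have := hr _ z
        refine ⟨j, by omega, x, ?_⟩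
        simp only [Sun, occupy]
        grind
      · have := hr _ z
        refine ⟨j+2, by omega, y, ?_⟩
        simp only [Sun, occupy]
        grind

lemma occ_eq_s8 (n : ℕ) (c : ℕ → Bool) :
    occ n c = ∑ i ∈ Finset.range n, if c (i+1) = true then 1 else 0 := by
  unfold occ
  rw [Finset.card_filter, Finset.range_eq_Ico, Finset.sum_Ico_add' (fun i => if c i = true then 1 else 0) 0 n 1]
  congr 1

lemma occ_ff (m : ℕ) (c : ℕ → Bool) (h : c 0 = false) : occ (m+3) (ff c) = occ m c + 2 := by
  simp [occ_eq_s8, Finset.sum_range_succ', ff, h, -Finset.sum_boole]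
  rfl


lemma occ_gg (m : ℕ) (c : ℕ → Bool) (h : c 0 = false) : occ (m+5) (gg c) = occ m c + 3 := by
  simp [occ_eq_s8, Finset.sum_range_succ', gg, h, -Finset.sum_boole]
  rfl


lemma EE_one {n : ℕ} {c : ℕ → Bool} (hn : 1 ≤ n) (h : EE n c) : c 1 = true := by
  obtain ⟨h0, -, h1, -⟩ := h
  have := h1 0 (by omega)
  grind

lemma EE_ff {m : ℕ} {c : ℕ → Bool} (hm : 1 ≤ m) (h : EE m c) : EE (m+3) (ff c) := by
  have h' := EE_one hm h
  obtain ⟨h0, hn, h1, h2⟩ := h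
  refine ⟨rfl, ?_, ?_, ?_⟩
  · intro i hi
    obtain ⟨i, rfl⟩ : ∃ k, i = k + 3 := ⟨i-3, by omega⟩
    exact hn i (by omega)
  · intro j hj hc
    match j with
    | 0 => simp [ff] at hc
    | 1 => simp [ff] at hc
    | 2 => simp [ff, h']
    | 3 => simp [ff, h'] at hc
    | j+4 => exact h1 (j+1) (by omega) hc
  · intro i
    match i with
    | 0 => simp [ff]
    | 1 => simp [ff, h0]
    | 2 => simp [ff, h0]
    | i+3 => exact h2 i

lemma EE_gg {m : ℕ} {c : ℕ → Bool} (hm : 1 ≤ m) (h : EE m c) : EE (m+5) (gg c) := by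
  have h' := EE_one hm h
  obtain ⟨h0, hn, h1, h2⟩ := h
  refine ⟨rfl, ?_, ?_, ?_⟩
  · intro i hi
    obtain ⟨i, rfl⟩ : ∃ k, i = k + 5 := ⟨i-5, by omega⟩
    exact hn i (by omega)
  · intro j hj hc
    match j with
    | 0 => simp [gg] at hc
    | 1 => simp [gg]
    | 2 => simp [gg] at hc
    | 3 => simp [gg] at hc
    | 4 => simp [gg, h']
    | 5 => simp [gg, h'] at hc
    | j+6 => exact h1 (j+1) (by omega) hc
  · intro i
    match i with
    | 0 => simp [gg]
    | 1 => simp [gg]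
    | 2 => simp [gg]
    | 3 => simp [gg, h0]
    | 4 => simp [gg, h0]
    | i+5 => exact h2 i

lemma EE_shift {a n : ℕ} {c : ℕ → Bool} (h : EE (n+a) c) (ha : c a = false) :
    EE n (fun i => c (i+a)) := by
  obtain ⟨h0, hn, h1, h2⟩ := h
  refine ⟨by simpa using ha, fun i hi => hn _ (by omega), ?_, ?_⟩
  · intro j hj hc
    have := h1 (j+a) (by omega) (by rw [← hc]; congr 1; omega)
    rw [show j + a + 2 = j + 2 + a by omega, show j + a + 3 = j + 3 + a by omega] at this
    rcases Nat.eq_zero_or_pos j with rfl | hj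
    · grind
    · rwa [show j + a - 1 = j - 1 + a by omega] at this
  · intro i
    have := h2 (i+a)
    rwa [show i + a + 2 = i + 2 + a by omega, show i + a + 1 = i + 1 + a by omega] at this

lemma EE_cases3 {n : ℕ} {c : ℕ → Bool} (h : EE (n+3) c) :
    (∃ d, EE n d ∧ c = ff d) ∨ (∃ m d, n = m + 1 ∧ c 5 = false ∧ c = gg d ∧ d = fun i => c (i + 5)) := by
  have hh := h
  have c1 := EE_one (by omega) h
  obtain ⟨h0, hn, h1, h2⟩ := h
  cases c2 : c 2
  · right
    have a := h1 1 (by omega) c2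
    have c3 : c 3 = true := a.2.1
    have c4 : c 4 = true := by
      have := a.2.2
      simpa [h0] using this
    have c5 : c 5 = false := by
      have := h2 3
      simp [c3, c4] at this
      exact this
    have hn0 : n ≠ 0 := by
      rintro rfl
      have := hn 4 (by omega); simp_all
    refine ⟨n-1, _, by omega, c5, ?_, rfl⟩
    funext i
    match i with
    | 0 => simp [gg, *]
    | 1 => simp [gg, *]
    | 2 => simp [gg, *]
    | 3 => simp [gg, *]
    | 4 => simp [gg, *]
    | i+5 => simp [gg]
  · left
    have c3 : c 3 = false := by
      have := h2 1
      simp [c1, c2] at this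
      exact this
    refine ⟨_, EE_shift hh c3, ?_⟩
    funext i
    match i with
    | 0 => simp [ff, *]
    | 1 => simp [ff, *]
    | 2 => simp [ff, *]
    | i+3 => simp [ff]

def z0 : ℕ → Bool := fun _ => false
def z1 : ℕ → Bool := fun i => i == 1
def z2 : ℕ → Bool := fun i => i == 1 || i == 2

lemma EE0 (c : ℕ → Bool) : EE 0 c ↔ c = z0 := by
  constructor
  · rintro ⟨h0, hn, -, -⟩
    funext i
    rcases Nat.eq_zero_or_pos i with rfl | hi
    · exact h0
    · exact hn i hi
  · rintro rfl; simp [EE, z0]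

lemma EE1 (c : ℕ → Bool) : EE 1 c ↔ c = z1 := by
  constructor
  · intro h
    have c1 := EE_one (by omega) h
    obtain ⟨h0, hn, -, -⟩ := h
    funext i
    match i with
    | 0 => simp [h0, z1]
    | 1 => simp [c1, z1]
    | i+2 => simp [hn (i+2) (by omega), z1]
  · rintro rfl; simp [EE, z1]; grind

lemma EE2 (c : ℕ → Bool) : EE 2 c ↔ c = z2 := by
  constructor
  · intro h
    have c1 := EE_one (by omega) h
    obtain ⟨h0, hn, h1, -⟩ := h
    have c2 : c 2 = true := by
      have := h1 1 (by omega)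
      have := hn 3 (by omega)
      grind
    funext i
    match i with
    | 0 => simp [h0, z2]
    | 1 => simp [c1, z2]
    | 2 => simp [c2, z2]
    | i+3 => simp [hn (i+3) (by omega), z2]
  · rintro rfl; simp [EE, z2]; grind

lemma EE_last {n : ℕ} {c : ℕ → Bool} (h : EE (n+1) c) : c (n+1) = true := by
  obtain ⟨h0, hn, h1, h2⟩ := h
  have := h1 n (by omega)
  have := hn (n+2) (by omega)
  grind

lemma EE3 (c : ℕ → Bool) : ¬ EE 3 c := by
  intro h
  rcases EE_cases3 (n := 0) h with ⟨d, hd, rfl⟩ | ⟨m, d, hm, -⟩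
  · have := EE_last h
    simp [ff, hd.1] at this
  · omega

lemma EE4 (c : ℕ → Bool) : EE 4 c ↔ c = ff z1 ∨ c = gg z0 := by
  constructor
  · intro h
    rcases EE_cases3 (n := 1) h with ⟨d, hd, rfl⟩ | ⟨m, d, hm, c5, hc, hd⟩
    · left; rw [(EE1 d).1 hd]
    · right
      rw [hc]; congr 1
      rw [hd]; funext i
      exact h.2.1 _ (by omega)
  · rintro (rfl | rfl)
    · exact EE_ff (by omega) ((EE1 _).2 rfl)
    · refine ⟨rfl, ?_, ?_, ?_⟩
      · intro i hi
        obtain ⟨i, rfl⟩ : ∃ k, i = k + 5 := ⟨i-5, by omega⟩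
        rfl
      · intro j hj; interval_cases j <;> simp [gg]
      · intro i
        match i with
        | 0 => simp [gg]
        | 1 => simp [gg]
        | 2 => simp [gg]
        | 3 => simp [gg, z0]
        | 4 => simp [gg, z0]
        | i+5 => simp [gg, z0]

lemma EE5 (c : ℕ → Bool) : EE 5 c ↔ c = ff z2 := by
  constructor
  · intro h
    rcases EE_cases3 (n := 2) h with ⟨d, hd, rfl⟩ | ⟨m, d, hm, c5, hc, hd⟩
    · rw [(EE2 d).1 hd]
    · have : c 5 = true := EE_last h
      rw [c5] at this; cases this
  · rintro rfl
    exact EE_ff (by omega) ((EE2 _).2 rfl)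

lemma EE6 (m : ℕ) (c : ℕ → Bool) : EE (m+6) c ↔
    (∃ d, EE (m+3) d ∧ ff d = c) ∨ (∃ d, EE (m+1) d ∧ gg d = c) := by
  constructor
  · intro h
    rcases EE_cases3 (n := m+3) h with ⟨d, hd, rfl⟩ | ⟨m', d, hm, c5, hc, hd⟩
    · left; exact ⟨d, hd, rfl⟩
    · right; refine ⟨d, ?_, hc.symm⟩
      rw [hd]
      exact EE_shift (a := 5) h c5
  · rintro (⟨d, hd, rfl⟩ | ⟨d, hd, rfl⟩)
    · exact EE_ff (by omega) hd
    · exact EE_gg (by omega) hd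

lemma JES_eq (k n : ℕ) : JES k n = Set.ncard {c | EE n c ∧ occ n c = k} := by
  unfold JES
  rw [← Nat.card_coe_set_eq]
  apply Nat.card_congr
  apply Equiv.subtypeEquivRight
  intro c
  simp only [Set.mem_ofPred_eq, ← EE_iff]
  tauto

lemma fin_EE (n k a : ℕ) : {c | EE n c ∧ occ n c + a = k}.Finite := by
  apply Set.Finite.of_injOn (f := fun c (i : Fin (n+1)) => c i.1) (t := Set.univ)
    (fun _ _ => trivial) _ Set.finite_univ
  rintro x ⟨hx, -⟩ y ⟨hy, -⟩ h
  funext i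
  by_cases hi : i < n + 1
  · exact congrFun h ⟨i, hi⟩
  · rw [hx.2.1 i (by omega), hy.2.1 i (by omega)]

lemma ncard_shift (k n a : ℕ) : Set.ncard {c | EE n c ∧ occ n c + a = k} =
    if a ≤ k then JES (k - a) n else 0 := by
  split_ifs with h
  · rw [JES_eq]; congr 1; ext c
    simp only [Set.mem_ofPred_eq]
    constructor <;> rintro ⟨x, y⟩ <;> exact ⟨x, by omega⟩
  · convert Set.ncard_empty (ℕ → Bool)
    ext c
    simp only [Set.mem_ofPred_eq, Set.mem_empty_iff_false, iff_false]
    rintro ⟨-, y⟩; omega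

lemma JES6 (k m : ℕ) : JES k (m+6) =
    (if 2 ≤ k then JES (k-2) (m+3) else 0) + (if 3 ≤ k then JES (k-3) (m+1) else 0) := by
  rw [← ncard_shift, ← ncard_shift,
    ← Set.ncard_image_of_injective {c | EE (m+3) c ∧ occ (m+3) c + 2 = k} ff_inj,
    ← Set.ncard_image_of_injective {c | EE (m+1) c ∧ occ (m+1) c + 3 = k} gg_inj,
    ← Set.ncard_union_eq ?_ ((fin_EE _ _ _).image _) ((fin_EE _ _ _).image _), JES_eq]
  · congr 1; ext c
    simp only [Set.mem_ofPred_eq, Set.mem_union, Set.mem_image, EE6]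
    constructor
    · rintro ⟨⟨d, hd, rfl⟩ | ⟨d, hd, rfl⟩, h⟩
      · rw [occ_ff (m+3) d hd.1] at h
        exact Or.inl ⟨d, ⟨hd, h⟩, rfl⟩
      · rw [occ_gg (m+1) d hd.1] at h
        exact Or.inr ⟨d, ⟨hd, h⟩, rfl⟩
    · rintro (⟨d, ⟨hd, h⟩, rfl⟩ | ⟨d, ⟨hd, h⟩, rfl⟩)
      · exact ⟨Or.inl ⟨d, hd, rfl⟩, by rw [occ_ff (m+3) d hd.1]; exact h⟩
      · exact ⟨Or.inr ⟨d, hd, rfl⟩, by rw [occ_gg (m+1) d hd.1]; exact h⟩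
  · rw [Set.disjoint_left]
    rintro _ ⟨d, -, rfl⟩ ⟨e, -, h⟩
    have := congrFun h 2
    simp [ff, gg] at this

lemma ncard_one (n k a : ℕ) (z : ℕ → Bool) (h : occ n z = a) (hz : ∀ c, EE n c ↔ c = z) :
    JES k n = if k = a then 1 else 0 := by
  rw [JES_eq]
  simp only [hz]
  split_ifs with hk
  · rw [Set.ncard_eq_one]; refine ⟨z, ?_⟩
    ext c; simp only [Set.mem_ofPred_eq, Set.mem_singleton_iff]
    constructor
    · exact fun h => h.1
    · rintro rfl; exact ⟨rfl, by omega⟩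
  · convert Set.ncard_empty (ℕ → Bool)
    ext c
    simp only [Set.mem_ofPred_eq, Set.mem_empty_iff_false, iff_false]
    rintro ⟨rfl, y⟩; omega

lemma JES0 (k : ℕ) : JES k 0 = if k = 0 then 1 else 0 :=
  ncard_one 0 k 0 z0 (by decide) EE0
lemma JES1 (k : ℕ) : JES k 1 = if k = 1 then 1 else 0 :=
  ncard_one 1 k 1 z1 (by decide) EE1
lemma JES2 (k : ℕ) : JES k 2 = if k = 2 then 1 else 0 :=
  ncard_one 2 k 2 z2 (by decide) EE2
lemma JES3 (k : ℕ) : JES k 3 = 0 := by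
  rw [JES_eq]; simp [EE3]
lemma JES5 (k : ℕ) : JES k 5 = if k = 4 then 1 else 0 :=
  ncard_one 5 k 4 (ff z2) (by decide) EE5
lemma JES4 (k : ℕ) : JES k 4 = if k = 3 then 2 else 0 := by
  rw [JES_eq]
  simp only [EE4]
  have h1 : occ 4 (ff z1) = 3 := by decide
  have h2 : occ 4 (gg z0) = 3 := by decide
  split_ifs with hk
  · rw [Set.ncard_eq_two]; refine ⟨ff z1, gg z0, ?_, ?_⟩
    · intro h
      have := congrFun h 2
      simp [ff, gg] at this
    ext c; simp only [Set.mem_ofPred_eq, Set.mem_insert_iff, Set.mem_singleton_iff]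
    constructor
    · exact fun h => h.1
    · rintro (rfl | rfl)
      · exact ⟨Or.inl rfl, by omega⟩
      · exact ⟨Or.inr rfl, by omega⟩
  · convert Set.ncard_empty (ℕ → Bool)
    ext c
    simp only [Set.mem_ofPred_eq, Set.mem_empty_iff_false, iff_false]
    rintro ⟨rfl | rfl, y⟩ <;> omega

lemma JES_gt (k n : ℕ) (h : n < k) : JES k n = 0 := by
  rw [JES_eq]
  convert Set.ncard_empty (ℕ → Bool)
  ext c
  simp only [Set.mem_ofPred_eq, Set.mem_empty_iff_false, iff_false]
  rintro ⟨-, y⟩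
  have : occ n c ≤ n := by
    unfold occ
    exact (Finset.card_filter_le _ _).trans (by simp)
  omega

lemma coeff_FES (d : Fin 2 →₀ ℕ) : MvPowerSeries.coeff d FES = (JES (d 0) (d 1) : ℤ) := by
  change (if d 0 ≤ d 1 then (JES (d 0) (d 1) : ℤ) else 0) = _
  split_ifs with h
  · rfl
  · rw [JES_gt _ _ (by omega)]; rfl

noncomputable def ee (a b : ℕ) : Fin 2 →₀ ℕ := Finsupp.single 0 a + Finsupp.single 1 b

lemma XY (a b : ℕ) : Xx ^ a * Yy ^ b = MvPowerSeries.monomial (ee a b) (1 : ℤ) := by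
  rw [Xx, Yy, MvPowerSeries.X_pow_eq, MvPowerSeries.X_pow_eq, MvPowerSeries.monomial_mul_monomial]
  simp [ee]

lemma ee_le (a b : ℕ) (d : Fin 2 →₀ ℕ) : ee a b ≤ d ↔ a ≤ d 0 ∧ b ≤ d 1 := by
  rw [Finsupp.le_def, Fin.forall_fin_two]
  simp [ee]

lemma eq_ee (a b : ℕ) (d : Fin 2 →₀ ℕ) : d = ee a b ↔ d 0 = a ∧ d 1 = b := by
  rw [Finsupp.ext_iff, Fin.forall_fin_two]
  simp [ee]

lemma coeff_XY (a b : ℕ) (d : Fin 2 →₀ ℕ) :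
    MvPowerSeries.coeff d (Xx ^ a * Yy ^ b) = if d 0 = a ∧ d 1 = b then (1 : ℤ) else 0 := by
  classical
  rw [XY, MvPowerSeries.coeff_monomial]
  simp only [eq_ee]

lemma coeff_XYF (a b : ℕ) (d : Fin 2 →₀ ℕ) :
    MvPowerSeries.coeff d (Xx ^ a * Yy ^ b * FES) =
      if a ≤ d 0 ∧ b ≤ d 1 then (JES (d 0 - a) (d 1 - b) : ℤ) else 0 := by
  classical
  rw [XY, MvPowerSeries.coeff_monomial_mul]
  simp only [ee_le, coeff_FES]
  simp [ee]

/-- `(1 - x² y³ - x³ y⁵) F^{ES}(x,y)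
  = 1 + x y + x² y² - x² y³ + x³ y⁴ - x³ y⁵`. -/
theorem stmt8 :
    (1 - Xx ^ 2 * Yy ^ 3 - Xx ^ 3 * Yy ^ 5) * FES =
      1 + Xx * Yy + Xx ^ 2 * Yy ^ 2 - Xx ^ 2 * Yy ^ 3 + Xx ^ 3 * Yy ^ 4
        - Xx ^ 3 * Yy ^ 5 := by
  have e1 : (1 : MvPowerSeries (Fin 2) ℤ) = Xx ^ 0 * Yy ^ 0 := by simp
  have e2 : Xx * Yy = Xx ^ 1 * Yy ^ 1 := by simp
  rw [sub_mul, sub_mul, one_mul, e2, e1]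
  ext d
  simp only [map_sub, map_add, coeff_XYF, coeff_FES, coeff_XY]
  generalize d 0 = k
  generalize d 1 = n
  match n with
  | 0 => simp [JES0]
  | 1 => simp [JES1]
  | 2 => simp [JES2]
  | 3 => simp [JES3, JES0]; grind
  | 4 => simp [JES4, JES1]; grind
  | 5 => simp [JES5, JES2, JES0]; grind
  | m+6 => simp [JES6, show m + 6 - 3 = m + 3 by omega, show m + 6 - 5 = m + 1 by omega, show 3 ≤ m + 6 by omega, show 5 ≤ m + 6 by omega]
end
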